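/- Downward Löwenheim–Skolem for saturation: Suppose λ is an infinite cardinal and B is a complete Boolean algebra such that 2^κ ≤ 2^λ for every cardinal κ < c.c.(B). Suppose U is an ultrafilter on B. Then there is a complete subalgebra B* of B with |B*| ≤ 2^λ such that U ∩ B* is an ultrafilter on B* and, for every complete countable first-order theory T, U ∩ B* λ⁺-saturates T (as an ultrafilter on the complete Boolean algebra B*) if and only if U λ⁺-saturates T. -/

import Mathlib

open FirstOrder FirstOrder.Language Cardinal

namespace BVal

/-! ### Filters and ultrafilters on complete Boolean algebras -/

variable {B : Type} [CompleteBooleanAlgebra B]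

/-- A filter on a complete Boolean algebra. -/
def IsBFilter (D : Set B) : Prop :=
  ⊤ ∈ D ∧ ⊥ ∉ D ∧ (∀ a b : B, a ∈ D → a ≤ b → b ∈ D) ∧
    (∀ a b : B, a ∈ D → b ∈ D → a ⊓ b ∈ D)

/-- An ultrafilter on a complete Boolean algebra. -/
def IsBUltrafilter (U : Set B) : Prop :=
  IsBFilter U ∧ ∀ a : B, a ∈ U ∨ aᶜ ∈ U

/-- An antichain in a complete Boolean algebra: pairwise disjoint nonzero elements. -/
def IsBAntichain (S : Set B) : Prop :=
  (∀ a ∈ S, a ≠ ⊥) ∧ S.Pairwise fun a b => a ⊓ b = ⊥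

/-- `ccOf B` is the least cardinal `κ` such that every antichain of `B` has cardinality `< κ`. -/
noncomputable def ccOf (B : Type) [CompleteBooleanAlgebra B] : Cardinal :=
  sInf {κ : Cardinal | ∀ S : Set B, IsBAntichain S → Cardinal.mk S < κ}

/-! ### Regularity -/

/-- An `I`-quasiregular family: finite meets are nonzero, countably infinite meets are zero. -/
def IsQuasiregularFamily {I : Type} (a : I → B) : Prop :=
  (∀ s : Finset I, s.inf a ≠ ⊥) ∧
    ∀ J : Set I, J.Countable → J.Infinite → (⨅ i ∈ J, a i) = ⊥

/-- An `I`-regular family: quasiregular, and the set of nonzero elements deciding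
every member of the family is dense. -/
def IsRegularFamily {I : Type} (a : I → B) : Prop :=
  IsQuasiregularFamily a ∧
    ∀ b : B, b ≠ ⊥ → ∃ b' : B, b' ≠ ⊥ ∧ b' ≤ b ∧ ∀ i, b' ≤ a i ∨ b' ≤ (a i)ᶜ

/-- A filter `D` is `lam`-regular if it contains some `lam`-regular family. -/
def IsRegularFilter (D : Set B) (lam : Cardinal) : Prop :=
  ∃ a : Quotient.out lam → B, IsRegularFamily a ∧ ∀ α, a α ∈ D

/-! ### Boolean-valued structures -/

/-- Plug the tuple `b` into the `Fin`-indexed free variables of the bounded formula `φ`,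
relabelling the parameters along `e`. -/
def plugEmb {L : FirstOrder.Language.{0, 0}} {C D : Type} {k : ℕ} (φ : L.BoundedFormula C k)
    (e : C → D) (b : Fin k → D) : L.Formula D :=
  φ.toFormula.relabel (Sum.elim e b)

/-- Plug the tuple `b` into the `Fin`-indexed free variables of the bounded formula `φ`. -/
def plug {L : FirstOrder.Language.{0, 0}} {C : Type} {k : ℕ} (φ : L.BoundedFormula C k)
    (b : Fin k → C) : L.Formula C :=
  plugEmb φ id b

/-- The finite conjunction of a list of bounded formulas. -/
def listConj {L : FirstOrder.Language.{0, 0}} {α : Type} {n : ℕ} :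
    List (L.BoundedFormula α n) → L.BoundedFormula α n
  | [] => ⊤
  | φ :: l => φ ⊓ listConj l

/-- The axioms for a `B`-valued `L`-structure with carrier `C` and evaluation map `val`,
where formulas with parameters from `C` are encoded as `L.Formula C` (the parameters being
the free variables): logically valid formulas get value `⊤`, negation and conjunction are
respected, the value of an existential formula is the supremum of the values of its instances,
and distinct elements are not identified. -/
def IsBVal {L : FirstOrder.Language.{0, 0}} {C : Type} (val : L.Formula C → B) : Prop :=
  (∀ φ : L.Formula C,
      (∀ (N : Type) [L.Structure N] [Nonempty N] (v : C → N), φ.Realize v) → val φ = ⊤) ∧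
  (∀ φ : L.Formula C, val φ.not = (val φ)ᶜ) ∧
  (∀ φ ψ : L.Formula C, val (φ ⊓ ψ) = val φ ⊓ val ψ) ∧
  (∀ φ : L.BoundedFormula C 1, val φ.ex = ⨆ a : C, val (plug φ fun _ => a)) ∧
  (∀ a b : C, a ≠ b → val (Term.equal (Term.var a) (Term.var b)) < ⊤)

/-- Fullness of a `B`-valued structure: every existential value is attained. -/
def IsFull {L : FirstOrder.Language.{0, 0}} {C : Type} (val : L.Formula C → B) : Prop :=
  ∀ φ : L.BoundedFormula C 1, ∃ a : C, val φ.ex = val (plug φ fun _ => a)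

/-- The `B`-valued structure gives every sentence of `T` the value `⊤`. -/
def BModels {L : FirstOrder.Language.{0, 0}} {C : Type} (val : L.Formula C → B) (T : L.Theory) : Prop :=
  ∀ φ ∈ T, val (Formula.relabel (fun e : Empty => e.elim) φ) = ⊤

/-- `val` is a full `B`-valued model of `T`. -/
def IsFullBModel {L : FirstOrder.Language.{0, 0}} (T : L.Theory) {C : Type}
    (val : L.Formula C → B) : Prop :=
  IsBVal val ∧ IsFull val ∧ BModels val T

/-- An elementary map between `B`-valued structures. -/
def ElemMap {L : FirstOrder.Language.{0, 0}} {C D : Type} (v : L.Formula C → B) (w : L.Formula D → B)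
    (f : C → D) : Prop :=
  ∀ φ : L.Formula C, v φ = w (φ.relabel f)

/-- `lam⁺`-saturation for full `B`-valued models of `T`: elementary maps from models of
cardinality at most `lam` extend along elementary extensions. -/
def BSaturated {L : FirstOrder.Language.{0, 0}} (T : L.Theory) (lam : Cardinal) {C : Type}
    (val : L.Formula C → B) : Prop :=
  ∀ (C0 C1 : Type) (v0 : L.Formula C0 → B) (v1 : L.Formula C1 → B),
    IsFullBModel T v0 → IsFullBModel T v1 → Cardinal.mk C1 ≤ lam →
    ∀ ι : C0 → C1, ElemMap v0 v1 ι →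
    ∀ f : C0 → C, ElemMap v0 val f →
    ∃ g : C1 → C, ElemMap v1 val g ∧ g ∘ ι = f

/-- `lam⁺`-universality for full `B`-valued models of `T`. -/
def BUniversal {L : FirstOrder.Language.{0, 0}} (T : L.Theory) (lam : Cardinal) {C : Type}
    (val : L.Formula C → B) : Prop :=
  ∀ (C1 : Type) (v1 : L.Formula C1 → B), IsFullBModel T v1 → Cardinal.mk C1 ≤ lam →
    ∃ f : C1 → C, ElemMap v1 val f

/-! ### Ordinary structures, specializations, ordinary saturation -/

/-- A bundled (nonempty) ordinary `L`-structure. -/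
structure OrdStructure (L : FirstOrder.Language.{0, 0}) : Type 1 where
  carrier : Type
  [str : L.Structure carrier]
  [nonempty' : Nonempty carrier]

attribute [instance] OrdStructure.str OrdStructure.nonempty'

instance {L : FirstOrder.Language.{0, 0}} : CoeSort (OrdStructure L) Type :=
  ⟨OrdStructure.carrier⟩

/-- `(N, π)` is a specialization of the `B`-valued structure `val` at the ultrafilter `U`:
`π` is surjective and a formula holds in `N` of the images iff its value lies in `U`. -/
def IsSpecialization {L : FirstOrder.Language.{0, 0}} {C : Type} (val : L.Formula C → B) (U : Set B)
    (N : Type) [L.Structure N] (π : C → N) : Prop :=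
  Function.Surjective π ∧ ∀ φ : L.Formula C, (val φ ∈ U ↔ φ.Realize π)

/-- An ordinary structure `N` is `lam⁺`-saturated: every finitely satisfiable set of formulas
in one free variable with parameters from a subset of `N` of cardinality at most `lam`
is realized in `N`. -/
def OrdSaturated (L : FirstOrder.Language.{0, 0}) (lam : Cardinal) (N : Type) [L.Structure N] : Prop :=
  ∀ A : Set N, Cardinal.mk A ≤ lam →
    ∀ p : Set (L.BoundedFormula A 1),
      (∀ s : Finset (L.BoundedFormula A 1), ↑s ⊆ p →
        ∃ b : N, ∀ φ ∈ s, BoundedFormula.Realize φ Subtype.val fun _ => b) →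
      ∃ b : N, ∀ φ ∈ p, BoundedFormula.Realize φ Subtype.val fun _ => b

/-- The ultrafilter `U` on `B` `lam⁺`-saturates the theory `T`: for every `lam⁺`-saturated
full `B`-valued model of `T`, every specialization at `U` is `lam⁺`-saturated. -/
def Saturates {L : FirstOrder.Language.{0, 0}} (U : Set B) (T : L.Theory) (lam : Cardinal) : Prop :=
  ∀ (C : Type) (val : L.Formula C → B), IsFullBModel T val → BSaturated T lam val →
    ∀ (N : Type) [L.Structure N] (π : C → N), IsSpecialization val U N π →
      OrdSaturated L lam N

/-! ### Distributions -/

/-- An `I`-distribution in `B`. -/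
def IsDistribution {I : Type} (A : Finset I → B) : Prop :=
  A ∅ = ⊤ ∧ (∀ s, A s ≠ ⊥) ∧ ∀ s t : Finset I, s ⊆ t → A t ≤ A s

/-- A multiplicative distribution. -/
def MultiplicativeDist {I : Type} (A : Finset I → B) : Prop :=
  ∀ s : Finset I, A s = s.inf fun i => A {i}

/-- `A'` refines `A`. -/
def Refines {I : Type} (A' A : Finset I → B) : Prop :=
  ∀ s, A' s ≤ A s

/-- `A'` conservatively refines `A`. -/
def ConsRefines {I : Type} (A' A : Finset I → B) : Prop :=
  ∀ s : Finset I, A' s = A s ⊓ s.inf fun i => A' {i}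

/-- The distribution `A` lies in the filter `D`. -/
def InFilter {I : Type} (A : Finset I → B) (D : Set B) : Prop :=
  ∀ s, A s ∈ D

/-- `A` has a multiplicative refinement in `D`. -/
def HasMultRefinement {I : Type} (A : Finset I → B) (D : Set B) : Prop :=
  ∃ A' : Finset I → B, IsDistribution A' ∧ MultiplicativeDist A' ∧ InFilter A' D ∧ Refines A' A

/-- A filter `D` is `lam⁺`-good if every `lam`-distribution in `D` has a multiplicative
refinement in `D`. -/
def IsGoodFilter (D : Set B) (lam : Cardinal) : Prop :=
  ∀ A : Finset (Quotient.out lam) → B, IsDistribution A → InFilter A D →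
    HasMultRefinement A D

/-- A distribution is regular if the family of its values at singletons is regular. -/
def IsRegularDistribution {I : Type} (A : Finset I → B) : Prop :=
  IsRegularFamily fun i => A {i}

/-! ### Łoś maps and possibilities -/

/-- An `I`-sequence of formulas `φ_i(x̄, ȳ_i)`: `x̄` has length `n`, `ȳ_i` has length `m i`. -/
structure FormulaSeq (L : FirstOrder.Language.{0, 0}) (I : Type) : Type 1 where
  n : ℕ
  m : I → ℕ
  φ : ∀ i, L.Formula (Fin n ⊕ Fin (m i))

/-- The formula `∃ x̄, ⋀_{i ∈ s} φ_i(x̄, ā_i)`, with parameters `a`. -/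
noncomputable def losFormula {L : FirstOrder.Language.{0, 0}} {C I : Type} (Φ : FormulaSeq L I)
    (a : ∀ i, Fin (Φ.m i) → C) (s : Finset I) : L.Formula C :=
  BoundedFormula.exs (listConj (s.toList.map fun i =>
    BoundedFormula.relabel
      (fun v : Fin Φ.n ⊕ Fin (Φ.m i) =>
        Sum.elim (fun k => Sum.inr k) (fun j => Sum.inl (a i j)) v)
      (Φ.φ i)))

/-- `A` is a `(I, T, Φ)`-Łoś map. -/
def IsLosMapFor {L : FirstOrder.Language.{0, 0}} (T : L.Theory) {I : Type} (A : Finset I → B)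
    (Φ : FormulaSeq L I) : Prop :=
  ∃ (C : Type) (val : L.Formula C → B), IsFullBModel T val ∧
    ∃ a : ∀ i, Fin (Φ.m i) → C, ∀ s : Finset I, A s = val (losFormula Φ a s)

/-- `A` is a `(I, T)`-Łoś map. -/
def IsLosMap {L : FirstOrder.Language.{0, 0}} (T : L.Theory) {I : Type} (A : Finset I → B) : Prop :=
  ∃ Φ : FormulaSeq L I, IsLosMapFor T A Φ

/-- `A` is a `(I, T)`-Łoś map witnessed by a formula sequence whose `x̄` has length `k`. -/
def IsLosMapOfArity {L : FirstOrder.Language.{0, 0}} (T : L.Theory) {I : Type} (A : Finset I → B)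
    (k : ℕ) : Prop :=
  ∃ Φ : FormulaSeq L I, Φ.n = k ∧ IsLosMapFor T A Φ

/-- `A` is a `(I, T)`-possibility: it conservatively refines some `(I, T)`-Łoś map. -/
def IsPossibility {L : FirstOrder.Language.{0, 0}} (T : L.Theory) {I : Type} (A : Finset I → B) : Prop :=
  ∃ A0 : Finset I → B, IsDistribution A0 ∧ IsLosMap T A0 ∧ ConsRefines A A0

/-! ### Partial types -/

/-- `p` is a partial type over the `B`-valued structure `val`: each finite conjunction has
nonzero existential value. -/
def IsPartialType {L : FirstOrder.Language.{0, 0}} {C : Type} (val : L.Formula C → B) {k : ℕ}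
    (p : Set (L.BoundedFormula C k)) : Prop :=
  ∀ Γ : Finset (L.BoundedFormula C k), ↑Γ ⊆ p →
    val (BoundedFormula.exs (listConj Γ.toList)) ≠ ⊥

/-- `p` is a partial `U`-type over `val`: each finite conjunction has existential value in `U`. -/
def IsUType {L : FirstOrder.Language.{0, 0}} {C : Type} (val : L.Formula C → B) (U : Set B) {k : ℕ}
    (p : Set (L.BoundedFormula C k)) : Prop :=
  ∀ Γ : Finset (L.BoundedFormula C k), ↑Γ ⊆ p →
    val (BoundedFormula.exs (listConj Γ.toList)) ∈ U

/-- The Łoś map of the partial type `p`, as a `p`-distribution. -/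
noncomputable def losOfType {L : FirstOrder.Language.{0, 0}} {C : Type} (val : L.Formula C → B) {k : ℕ}
    (p : Set (L.BoundedFormula C k)) : Finset ↥p → B := fun Γ =>
  val (BoundedFormula.exs (listConj (Γ.toList.map Subtype.val)))

/-! ### Boolean ultrapowers -/

/-- The carrier of the Boolean ultrapower `M^B`: maximal antichains indexed by `M`. -/
def BUP (B : Type) [CompleteBooleanAlgebra B] (M : Type) : Type :=
  {a : M → B // (∀ m m' : M, m ≠ m' → a m ⊓ a m' = ⊥) ∧ (⨆ m, a m) = ⊤}

/-- The evaluation map of the Boolean ultrapower `M^B`. -/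
noncomputable def bupVal (B : Type) [CompleteBooleanAlgebra B] {L : FirstOrder.Language.{0, 0}}
    (M : Type) [L.Structure M] : L.Formula (BUP B M) → B := fun φ =>
  letI : DecidableEq (BUP B M) := Classical.decEq _
  ⨆ (w : BUP B M → M) (_ : φ.Realize w), φ.freeVarFinset.inf fun c => c.1 (w c)

/-- A bundled complete Boolean algebra. -/
structure CBA : Type 1 where
  carrier : Type
  [str : CompleteBooleanAlgebra carrier]

attribute [instance] CBA.str

instance : CoeSort CBA Type := ⟨CBA.carrier⟩

end BVal

open BVal

open FirstOrder FirstOrder.Language Cardinal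
open BVal

namespace DLS

/-! ### Ultrafilters and Sikorski's extension theorem -/

theorem buf_top {B : Type} [CompleteBooleanAlgebra B] {U : Set B} (hU : IsBUltrafilter U) : ⊤ ∈ U :=
  hU.1.1

theorem buf_mono {B : Type} [CompleteBooleanAlgebra B] {U : Set B} (hU : IsBUltrafilter U)
    {a b : B} (ha : a ∈ U) (h : a ≤ b) : b ∈ U := hU.1.2.2.1 a b ha h

theorem buf_inf {B : Type} [CompleteBooleanAlgebra B] {U : Set B} (hU : IsBUltrafilter U)
    {a b : B} : a ⊓ b ∈ U ↔ a ∈ U ∧ b ∈ U :=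
  ⟨fun h => ⟨buf_mono hU h inf_le_left, buf_mono hU h inf_le_right⟩,
    fun h => hU.1.2.2.2 a b h.1 h.2⟩

theorem buf_compl {B : Type} [CompleteBooleanAlgebra B] {U : Set B} (hU : IsBUltrafilter U)
    {a : B} : aᶜ ∈ U ↔ a ∉ U := by
  constructor
  · intro h h'
    have := (buf_inf hU).2 ⟨h', h⟩
    rw [inf_compl_eq_bot] at this
    exact hU.1.2.1 this
  · intro h
    exact (hU.2 a).resolve_left h

theorem buf_ne_bot {B : Type} [CompleteBooleanAlgebra B] {U : Set B} (hU : IsBUltrafilter U)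
    {a : B} (ha : a ∈ U) : a ≠ ⊥ := by
  rintro rfl
  exact hU.1.2.1 ha

theorem buf_finset_inf {B : Type} [CompleteBooleanAlgebra B] {U : Set B} (hU : IsBUltrafilter U)
    {I : Type*} (s : Finset I) (g : I → B) : s.inf g ∈ U ↔ ∀ i ∈ s, g i ∈ U := by
  classical
  induction s using Finset.induction_on with
  | empty => simp [buf_top hU]
  | insert a s has ih => rw [Finset.inf_insert, buf_inf hU, ih]; simp

theorem exists_buf {B : Type} [CompleteBooleanAlgebra B] {b : B} (hb : b ≠ ⊥) :
    ∃ U : Set B, IsBUltrafilter U ∧ b ∈ U := by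
  obtain ⟨J, hJ, -, hd⟩ := DistribLattice.prime_ideal_of_disjoint_filter_ideal
    (F := Order.PFilter.principal b) (I := Order.Ideal.principal (⊥ : B)) (by
      rw [Set.disjoint_left]
      intro x hx hx'
      have h1 : b ≤ x := hx
      have h2 : x ≤ ⊥ := hx'
      exact hb (le_bot_iff.1 (h1.trans h2)))
  have hbJ : b ∉ J := fun h => (Set.disjoint_left.1 hd) (show b ∈ (Order.PFilter.principal b : Set B) from le_refl b) h
  refine ⟨{x | x ∉ J}, ⟨⟨?_, ?_, ?_, ?_⟩, ?_⟩, hbJ⟩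
  · exact fun h => hbJ (J.lower le_top h)
  · exact fun h => h J.bot_mem
  · intro a b ha hab hb
    exact ha (J.lower hab hb)
  · intro a b ha hb h
    rcases hJ.mem_or_mem h with h | h
    · exact ha h
    · exact hb h
  · intro a
    by_contra h
    simp only [Set.mem_ofPred_eq, not_or, not_not] at h
    have : a ⊔ aᶜ ∈ J := J.sup_mem h.1 h.2
    rw [sup_compl_eq_top] at this
    exact hbJ (J.lower le_top this)

/-- Compatibility of a set of pairs. -/
def Compat {A B : Type*} [BooleanAlgebra A] [CompleteBooleanAlgebra B] (G : Set (A × B)) : Prop :=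
  ∀ s t : Finset (A × B), (s : Set (A × B)) ⊆ G → (t : Set (A × B)) ⊆ G →
    s.inf Prod.fst ≤ t.sup Prod.fst → s.inf Prod.snd ≤ t.sup Prod.snd

theorem compat_sUnion {A B : Type*} [BooleanAlgebra A] [CompleteBooleanAlgebra B]
    (c : Set (Set (A × B))) (hc : IsChain (· ⊆ ·) c) (hne : c.Nonempty)
    (h : ∀ G ∈ c, Compat G) : Compat (⋃₀ c) := by
  classical
  intro s t hs ht hst
  have : ∃ G ∈ c, ((s ∪ t : Finset (A × B)) : Set (A × B)) ⊆ G := by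
    refine DirectedOn.exists_mem_subset_of_finset_subset_biUnion (f := id) hne
      (hc.directedOn) ?_
    rw [Finset.coe_union]
    simpa [Set.sUnion_eq_biUnion] using And.intro hs ht
  obtain ⟨G, hG, hsub⟩ := this
  rw [Finset.coe_union, Set.union_subset_iff] at hsub
  exact h G hG s t hsub.1 hsub.2 hst

theorem compat_insert {A B : Type*} [BooleanAlgebra A] [CompleteBooleanAlgebra B]
    (G : Set (A × B)) (hG : Compat G) (a : A) : ∃ b : B, Compat (insert (a, b) G) := by
  classical
  let b : B := ⨆ (s : Finset (A × B)) (t : Finset (A × B)) (_ : (s : Set (A × B)) ⊆ G)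
    (_ : (t : Set (A × B)) ⊆ G) (_ : s.inf Prod.fst ≤ a ⊔ t.sup Prod.fst),
      s.inf Prod.snd \ t.sup Prod.snd
  refine ⟨b, ?_⟩
  intro s t hs ht hst
  -- split off `(a,b)`
  have key : ∀ u : Finset (A × B), (u : Set (A × B)) ⊆ insert (a, b) G →
      ((u.erase (a, b) : Finset (A × B)) : Set (A × B)) ⊆ G := by
    intro u hu x hx
    simp only [Finset.coe_erase, Set.mem_sdiff, Finset.mem_coe, Set.mem_singleton_iff] at hx
    exact (hu hx.1).resolve_left hx.2
  have hs' := key s hs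
  have ht' := key t ht
  by_cases has : (a, b) ∈ s
  · by_cases hat : (a, b) ∈ t
    · exact (Finset.inf_le has).trans (Finset.le_sup (f := Prod.snd) hat)
    · rw [Finset.erase_eq_of_notMem hat] at ht'
      rw [← Finset.insert_erase has, Finset.inf_insert] at hst ⊢
      set s' := s.erase (a, b)
      change b ⊓ _ ≤ _
      change a ⊓ _ ≤ _ at hst
      simp only [b, iSup_inf_eq, iSup_le_iff]
      intro s2 t2 hs2 ht2 h2
      have := hG (s2 ∪ s') (t2 ∪ t) (by simp [hs2, hs']) (by simp [ht2, ht']) (by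
        rw [Finset.inf_union, Finset.sup_union]
        calc s2.inf Prod.fst ⊓ s'.inf Prod.fst ≤ (a ⊔ t2.sup Prod.fst) ⊓ s'.inf Prod.fst := by gcongr
          _ ≤ (a ⊓ s'.inf Prod.fst) ⊔ t2.sup Prod.fst := by
            rw [inf_sup_right]; gcongr; exact inf_le_left
          _ ≤ _ := by rw [sup_comm]; gcongr)
      rw [Finset.inf_union, Finset.sup_union] at this
      rw [sdiff_eq, inf_right_comm, ← sdiff_eq, sdiff_le_iff]
      exact this
  · rw [Finset.erase_eq_of_notMem has] at hs'
    by_cases hat : (a, b) ∈ t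
    · rw [← Finset.insert_erase hat, Finset.sup_insert] at hst ⊢
      set t' := t.erase (a, b)
      change _ ≤ b ⊔ _
      change _ ≤ a ⊔ _ at hst
      rw [sup_comm, ← sdiff_le_iff]
      exact le_iSup_of_le s (le_iSup_of_le t' (le_iSup_of_le hs' (le_iSup_of_le ht'
        (le_iSup_of_le hst le_rfl))))
    · rw [Finset.erase_eq_of_notMem hat] at ht'
      exact hG s t hs' ht' hst

/-- Sikorski's extension theorem. -/
theorem sikorski {A B : Type*} [BooleanAlgebra A] [CompleteBooleanAlgebra B]
    (G : Set (A × B)) (hG : Compat G) :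
    ∃ F : A → B, (∀ x ∈ G, F x.1 = x.2) ∧ (∀ a b, F (a ⊓ b) = F a ⊓ F b) ∧
      (∀ a, F aᶜ = (F a)ᶜ) ∧ F ⊤ = ⊤ ∧ Monotone F := by
  classical
  obtain ⟨M, hGM, hM⟩ := zorn_subset_nonempty {G : Set (A × B) | Compat G}
    (fun c hc hch hne => ⟨⋃₀ c, compat_sUnion c hch hne (fun G h => hc h),
      fun s hs => Set.subset_sUnion_of_mem hs⟩) G hG
  have hMc : Compat M := hM.prop
  have htot : ∀ a, ∃ b, (a, b) ∈ M := by
    intro a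
    obtain ⟨b, hb⟩ := compat_insert M hMc a
    exact ⟨b, hM.le_of_ge hb (Set.subset_insert _ _) (Set.mem_insert _ _)⟩
  have hle : ∀ a b a' b', (a, b) ∈ M → (a', b') ∈ M → a ≤ a' → b ≤ b' := by
    intro a b a' b' h h' hl
    simpa using hMc {(a, b)} {(a', b')} (by simpa using h) (by simpa using h') (by simpa using hl)
  choose F hF using htot
  have hmono : Monotone F := fun a b h => hle _ _ _ _ (hF a) (hF b) h
  have hinf : ∀ a b, F (a ⊓ b) = F a ⊓ F b := by
    intro a b
    apply le_antisymm
    · exact le_inf (hmono inf_le_left) (hmono inf_le_right)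
    · have := hMc {(a, F a), (b, F b)} {(a ⊓ b, F (a ⊓ b))}
        (by intro x hx; simp at hx; rcases hx with rfl | rfl <;> exact hF _)
        (by intro x hx; simp at hx; subst hx; exact hF _) (by simp)
      simpa using this
  have htop : F ⊤ = ⊤ := by
    have := hMc ∅ {(⊤, F ⊤)} (by simp) (by simpa using hF ⊤) (by simp)
    simpa using this
  have hbot : F ⊥ = ⊥ := by
    have := hMc {(⊥, F ⊥)} ∅ (by simpa using hF ⊥) (by simp) (by simp)
    simpa using this
  refine ⟨F, ?_, hinf, ?_, htop, hmono⟩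
  · rintro ⟨a, b⟩ h
    exact le_antisymm (hle _ _ _ _ (hF a) (hGM h) le_rfl) (hle _ _ _ _ (hGM h) (hF a) le_rfl)
  · intro a
    refine eq_compl_iff_isCompl.2 (IsCompl.of_eq ?_ ?_)
    · rw [← hinf, compl_inf_eq_bot, hbot]
    · have := hMc ∅ {(a, F a), (aᶜ, F aᶜ)} (by simp)
        (by intro x hx; simp at hx; rcases hx with rfl | rfl <;> exact hF _) (by simp)
      rw [sup_comm]
      simpa using this

/-- Sikorski's theorem, in the form used below. -/
theorem sikorski_family {Ω I B : Type} [CompleteBooleanAlgebra B] (R : I → Set Ω) (g : I → B)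
    (h : ∀ u : Set B, IsBUltrafilter u → ∀ s : Finset I, ∃ ω : Ω, ∀ i ∈ s, (ω ∈ R i ↔ g i ∈ u)) :
    ∃ F : Set Ω → B, (∀ i, F (R i) = g i) ∧ (∀ a b, F (a ⊓ b) = F a ⊓ F b) ∧
      (∀ a, F aᶜ = (F a)ᶜ) ∧ F ⊤ = ⊤ ∧ Monotone F := by
  classical
  obtain ⟨F, h1, h2⟩ := sikorski (A := Set Ω) (B := B) (Set.range fun i => (R i, g i)) (by
    intro s t hs ht hst
    rw [← Set.image_univ] at hs
    obtain ⟨s', -, rfl⟩ := Finset.subset_set_image_iff.1 hs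
    rw [← Set.image_univ] at ht
    obtain ⟨t', -, rfl⟩ := Finset.subset_set_image_iff.1 ht
    rw [Finset.inf_image, Finset.sup_image] at hst ⊢
    by_contra hne
    have hne' : (s'.inf g ⊓ (t'.sup g)ᶜ) ≠ ⊥ := by
      intro h0
      exact hne (by
        rw [← sdiff_eq, sdiff_eq_bot_iff] at h0
        exact h0)
    obtain ⟨u, hu, hm⟩ := exists_buf hne'
    rw [buf_inf hu, Finset.compl_sup, buf_finset_inf hu, buf_finset_inf hu] at hm
    obtain ⟨ω, hω⟩ := h u hu (s' ∪ t')
    have h1 : ω ∈ s'.inf R := by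
      rw [Finset.inf_eq_iInf]
      simp only [Set.iInf_eq_iInter, Set.mem_iInter]
      intro i hi
      exact (hω i (Finset.mem_union_left _ hi)).2 (hm.1 i hi)
    have h2 := hst h1
    rw [show (Prod.fst ∘ fun i => (R i, g i)) = R from rfl, Finset.sup_eq_iSup] at h2
    simp only [Set.iSup_eq_iUnion, Set.mem_iUnion] at h2
    obtain ⟨i, hi, h2⟩ := h2
    exact (buf_compl hu).1 (hm.2 i hi) ((hω i (Finset.mem_union_right _ hi)).1 h2))
  exact ⟨F, fun i => h1 _ ⟨i, rfl⟩, h2⟩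

end DLS

open FirstOrder FirstOrder.Language Cardinal
open BVal

namespace DLS

/-! ### Valuations -/

/-- The propositional part of the axioms of a `B`-valued structure. -/
def HV {B : Type} [CompleteBooleanAlgebra B] {L : FirstOrder.Language.{0, 0}} {C : Type}
    (val : L.Formula C → B) : Prop :=
  (∀ φ : L.Formula C,
      (∀ (N : Type) [L.Structure N] [Nonempty N] (v : C → N), φ.Realize v) → val φ = ⊤) ∧
  (∀ φ : L.Formula C, val φ.not = (val φ)ᶜ) ∧
  (∀ φ ψ : L.Formula C, val (φ ⊓ ψ) = val φ ⊓ val ψ)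

theorem IsBVal.hv {B : Type} [CompleteBooleanAlgebra B] {L : FirstOrder.Language.{0, 0}} {C : Type}
    {val : L.Formula C → B} (h : IsBVal val) : HV val := ⟨h.1, h.2.1, h.2.2.1⟩

theorem HV.mono {B : Type} [CompleteBooleanAlgebra B] {L : FirstOrder.Language.{0, 0}} {C : Type}
    {val : L.Formula C → B} (h : HV val) {φ ψ : L.Formula C}
    (hi : ∀ (N : Type) [L.Structure N] [Nonempty N] (v : C → N), φ.Realize v → ψ.Realize v) :
    val φ ≤ val ψ := by
  have h1 := h.1 ((φ ⊓ ψ.not).not) (by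
    intro N _ _ v
    rw [Formula.realize_not, Formula.realize_inf, Formula.realize_not]
    have := hi N v
    tauto)
  rw [h.2.1, h.2.2, h.2.1, compl_eq_top, ← sdiff_eq, sdiff_eq_bot_iff] at h1
  exact h1

theorem HV.congr {B : Type} [CompleteBooleanAlgebra B] {L : FirstOrder.Language.{0, 0}} {C : Type}
    {val : L.Formula C → B} (h : HV val) {φ ψ : L.Formula C}
    (hi : ∀ (N : Type) [L.Structure N] [Nonempty N] (v : C → N), φ.Realize v ↔ ψ.Realize v) :
    val φ = val ψ :=
  le_antisymm (h.mono fun N _ _ v => (hi N v).1) (h.mono fun N _ _ v => (hi N v).2)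

theorem HV.relabel {B : Type} [CompleteBooleanAlgebra B] {L : FirstOrder.Language.{0, 0}}
    {C D : Type} {val : L.Formula D → B} (h : HV val) (f : C → D) :
    HV (fun φ : L.Formula C => val (φ.relabel f)) := by
  refine ⟨?_, ?_, ?_⟩
  · intro φ hφ
    exact h.1 _ fun N _ _ v => by rw [Formula.realize_relabel]; exact hφ N _
  · intro φ
    rw [← h.2.1]
    exact h.congr fun N _ _ v => by simp [Formula.realize_relabel, Formula.realize_not]
  · intro φ ψ
    rw [← h.2.2]
    exact h.congr fun N _ _ v => by simp [Formula.realize_relabel, Formula.realize_inf]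

theorem HV.relabel_relabel {B : Type} [CompleteBooleanAlgebra B] {L : FirstOrder.Language.{0, 0}}
    {C D E : Type} {val : L.Formula E → B} (h : HV val) (f : C → D) (g : D → E) (φ : L.Formula C) :
    val ((φ.relabel f).relabel g) = val (φ.relabel (g ∘ f)) :=
  h.congr fun N _ _ v => by simp only [Formula.realize_relabel, Function.comp_assoc]

theorem HV.relabel_id {B : Type} [CompleteBooleanAlgebra B] {L : FirstOrder.Language.{0, 0}}
    {C : Type} {val : L.Formula C → B} (h : HV val) (φ : L.Formula C) :
    val (φ.relabel id) = val φ :=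
  h.congr fun N _ _ v => by simp only [Formula.realize_relabel, Function.comp_id]

/-- Finite conjunctions. -/
noncomputable def fconj {L : FirstOrder.Language.{0, 0}} {C : Type} {I : Type*} (s : Finset I)
    (f : I → L.Formula C) : L.Formula C := Formula.iInf fun i : s => f i

theorem realize_fconj {L : FirstOrder.Language.{0, 0}} {C : Type} {I : Type*} (s : Finset I)
    (f : I → L.Formula C) {N : Type} [L.Structure N] (v : C → N) :
    (fconj s f).Realize v ↔ ∀ i ∈ s, (f i).Realize v := by
  simp [fconj, Formula.realize_iInf]

theorem HV.fconj {B : Type} [CompleteBooleanAlgebra B] {L : FirstOrder.Language.{0, 0}}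
    {C : Type} {val : L.Formula C → B} (h : HV val) {I : Type*} (s : Finset I)
    (f : I → L.Formula C) : val (fconj s f) = s.inf fun i => val (f i) := by
  classical
  induction s using Finset.induction_on with
  | empty => exact h.1 _ fun N _ _ v => by simp [realize_fconj]
  | insert a s has ih =>
    rw [Finset.inf_insert, ← ih, ← h.2.2]
    exact h.congr fun N _ _ v => by simp [realize_fconj, Formula.realize_inf]

theorem realize_congr_fv {L : FirstOrder.Language.{0, 0}} {C : Type} [DecidableEq C]
    (φ : L.Formula C) {N : Type} [L.Structure N] {v v' : C → N}
    (h : ∀ c ∈ φ.freeVarFinset, v c = v' c) : φ.Realize v ↔ φ.Realize v' := by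
  have h1 := BoundedFormula.realize_restrictFreeVar (φ := φ) (f := id)
    (v := fun a => v a) (v' := v) (xs := default) (by simp)
  have h2 := BoundedFormula.realize_restrictFreeVar (φ := φ) (f := id)
    (v := fun a => v a) (v' := v') (xs := default) (by intro a; exact h a.1 a.2)
  exact h1.symm.trans h2

/-- Existential quantification of all variables outside the range of `ι`. -/
theorem exists_proj {L : FirstOrder.Language.{0, 0}} {C D : Type} (ι : C → D)
    (hι : Function.Injective ι) (ψ : L.Formula D) :
    ∃ ψ' : L.Formula C,
      (∀ (N : Type) [L.Structure N] [Nonempty N] (w : D → N), ψ.Realize w → ψ'.Realize (w ∘ ι)) ∧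
      (∀ (N : Type) [L.Structure N] [Nonempty N] (w0 : C → N), ψ'.Realize w0 →
        ∃ w : D → N, w ∘ ι = w0 ∧ ψ.Realize w) := by
  classical
  let r : D → C ⊕ Option ψ.freeVarFinset := fun d =>
    if h : ∃ c, ι c = d then Sum.inl h.choose
    else if h' : d ∈ ψ.freeVarFinset then Sum.inr (some ⟨d, h'⟩) else Sum.inr none
  have hr : ∀ c, r (ι c) = Sum.inl c := by
    intro c
    have h : ∃ c', ι c' = ι c := ⟨c, rfl⟩
    simp only [r, dif_pos h]
    exact congrArg _ (hι h.choose_spec)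
  refine ⟨(ψ.relabel r).iExs (Option ψ.freeVarFinset), ?_, ?_⟩
  · intro N _ _ w hw
    rw [Formula.realize_iExs]
    refine ⟨fun o => o.elim (Classical.arbitrary N) fun d => w d, ?_⟩
    rw [Formula.realize_relabel]
    refine (realize_congr_fv ψ ?_).1 hw
    intro d hd
    simp only [Function.comp, r]
    split_ifs with h
    · simp [h.choose_spec]
    · simp
  · intro N _ _ w0 hw
    rw [Formula.realize_iExs] at hw
    obtain ⟨i, hi⟩ := hw
    rw [Formula.realize_relabel] at hi
    refine ⟨_, ?_, hi⟩
    funext c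
    simp [hr]

/-- A formula with nonzero value in a Boolean-valued model of a complete theory is satisfiable
in every ordinary model. -/
theorem exists_real {B : Type} [CompleteBooleanAlgebra B] {L : FirstOrder.Language.{0, 0}}
    {T : L.Theory} (hT : T.IsComplete) {N : Type} [L.Structure N] [Nonempty N] (hN : N ⊨ T)
    {C : Type} {val : L.Formula C → B} (h : HV val) (hm : BModels val T) {φ : L.Formula C}
    (hφ : val φ ≠ ⊥) : ∃ w : C → N, φ.Realize w := by
  classical
  by_contra hcon
  obtain ⟨σ, h1, h2⟩ := exists_proj (fun e : Empty => (e.elim : C)) (fun e => e.elim) φ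
  have hNσ : ¬ (N ⊨ (σ : L.Sentence)) := by
    intro hs
    obtain ⟨w, -, hw⟩ := h2 N default hs
    exact hcon ⟨w, hw⟩
  have hTσ : T ⊨ᵇ (Formula.not σ : L.Sentence) := by
    rw [hT.models_not_iff σ, ← hT.realize_sentence_iff σ N]
    exact hNσ
  obtain ⟨T0, hT0, hT0'⟩ := (Theory.models_iff_finset_models).1 hTσ
  have h3 : val (fconj T0 fun τ => Formula.relabel (fun e : Empty => e.elim) τ) = ⊤ := by
    rw [h.fconj]
    refine (Finset.inf_congr rfl (g := fun _ => (⊤ : B)) fun τ hτ => hm τ (hT0 hτ)).trans ?_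
    simp
  have h4 : val (fconj T0 fun τ => Formula.relabel (fun e : Empty => e.elim) τ) ≤ val φ.not := by
    refine h.mono ?_
    intro N' _ _ v hv
    rw [realize_fconj] at hv
    have hmod : N' ⊨ (T0 : L.Theory) := by
      rw [Theory.model_iff]
      intro τ hτ
      have := hv τ hτ
      rw [Formula.realize_relabel] at this
      rw [Sentence.Realize]
      convert this
    have := hT0'.realize_sentence N'
    rw [Formula.realize_not]
    intro hφv
    have h5 := h1 N' v hφv
    have h6 : Formula.Realize σ (default : Empty → N') := by
      convert h5
    exact ((Sentence.realize_not (φ := σ) N').1 this) h6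
  rw [h3, top_le_iff, h.2.1, compl_eq_top] at h4
  exact hφ h4

theorem realize_plug {L : FirstOrder.Language.{0, 0}} {C : Type} (φ : L.BoundedFormula C 1)
    (a : C) {N : Type} [L.Structure N] (w : C → N) :
    (plug φ fun _ => a).Realize w ↔ φ.Realize w (fun _ => w a) := by
  rw [plug, plugEmb, Formula.realize_relabel, BoundedFormula.realize_toFormula]
  rfl

theorem realize_ex1 {L : FirstOrder.Language.{0, 0}} {C : Type} (φ : L.BoundedFormula C 1)
    {N : Type} [L.Structure N] (w : C → N) :
    Formula.Realize (φ.ex) w ↔ ∃ x : N, φ.Realize w (fun _ => x) := by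
  rw [Formula.Realize, BoundedFormula.realize_ex]
  refine exists_congr fun x => ?_
  have e : (Fin.snoc default x : Fin (0 + 1) → N) = fun _ => x := by
    funext i
    have hi : i = Fin.last 0 := by ext; simp
    rw [hi, Fin.snoc_last]
  rw [e]

theorem HV.isBVal {B : Type} [CompleteBooleanAlgebra B] {L : FirstOrder.Language.{0, 0}}
    {C : Type} {val : L.Formula C → B} (h : HV val) (hf : IsFull val)
    (hd : ∀ a b : C, val (Term.equal (Term.var a) (Term.var b)) = ⊤ → a = b) : IsBVal val := by
  refine ⟨h.1, h.2.1, h.2.2, ?_, ?_⟩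
  · intro φ
    apply le_antisymm
    · obtain ⟨a, ha⟩ := hf φ
      rw [ha]
      exact le_iSup (fun a => val (plug φ fun _ => a)) a
    · refine iSup_le fun a => h.mono fun N _ _ w hw => ?_
      rw [realize_ex1]
      exact ⟨_, (realize_plug φ a w).1 hw⟩
  · intro a b hab
    exact lt_top_iff_ne_top.2 fun h' => hab (hd a b h')

theorem IsBVal.distinct {B : Type} [CompleteBooleanAlgebra B] {L : FirstOrder.Language.{0, 0}}
    {C : Type} {val : L.Formula C → B} (h : IsBVal val) (a b : C)
    (hab : val (Term.equal (Term.var a) (Term.var b)) = ⊤) : a = b := by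
  by_contra hne
  exact (h.2.2.2.2 a b hne).ne hab

/-- Fullness for formulas in `C ⊕ Unit`. -/
theorem full_unit {B : Type} [CompleteBooleanAlgebra B] {L : FirstOrder.Language.{0, 0}}
    {C : Type} {val : L.Formula C → B} (h : HV val) (hf : IsFull val) (ψ : L.Formula (C ⊕ Unit)) :
    ∃ a : C, val (ψ.iExs Unit) = val (ψ.relabel (Sum.elim id fun _ => a)) := by
  let φ : L.BoundedFormula C 1 :=
    BoundedFormula.relabel (n := 1) (k := 0) (Sum.map id fun _ => (0 : Fin 1)) ψ
  have hφ : ∀ (N : Type) [L.Structure N] (w : C → N) (x : N),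
      φ.Realize w (fun _ => x) ↔ ψ.Realize (Sum.elim w fun _ => x) := by
    intro N _ w x
    have := BoundedFormula.realize_relabel (m := 1) (n := 0) (φ := ψ)
      (g := (Sum.map id fun _ => (0 : Fin 1))) (v := w) (xs := fun _ : Fin 1 => x)
    refine this.trans ?_
    rw [Formula.Realize]
    have e : (Sum.elim w ((fun _ : Fin 1 => x) ∘ Fin.castAdd 0) ∘ Sum.map id fun _ : Unit => (0 : Fin 1))
        = Sum.elim w fun _ => x := by
      funext c; rcases c with c | c <;> rfl
    rw [e]
    have e2 : ((fun _ : Fin 1 => x) ∘ Fin.natAdd 1 : Fin 0 → N) = default := Subsingleton.elim _ _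
    rw [e2]
  obtain ⟨a, ha⟩ := hf φ
  refine ⟨a, ?_⟩
  trans val φ.ex
  · refine h.congr fun N _ _ w => ?_
    rw [Formula.realize_iExs, realize_ex1]
    constructor
    · rintro ⟨i, hi⟩
      exact ⟨i (), (hφ N w _).2 hi⟩
    · rintro ⟨x, hx⟩
      exact ⟨fun _ => x, (hφ N w _).1 hx⟩
  · rw [ha]
    refine h.congr fun N _ _ w => ?_
    rw [realize_plug, hφ, Formula.realize_relabel]
    have : Sum.elim w (fun _ : Unit => w a) = w ∘ Sum.elim id (fun _ => a) := by
      funext c; rcases c with c | c <;> rfl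
    rw [this]

theorem elem_injective {B : Type} [CompleteBooleanAlgebra B] {L : FirstOrder.Language.{0, 0}}
    {C D : Type} {v : L.Formula C → B} {w : L.Formula D → B} (hv : IsBVal v) (hw : HV w)
    {f : C → D} (hf : ElemMap v w f) : Function.Injective f := by
  intro a b hab
  apply IsBVal.distinct hv
  rw [hf]
  refine hw.1 _ fun N _ _ x => ?_
  rw [Formula.realize_relabel, Formula.realize_equal]
  simp [hab]

theorem full_nonempty {B : Type} [CompleteBooleanAlgebra B] {L : FirstOrder.Language.{0, 0}}
    {C : Type} {val : L.Formula C → B} (hf : IsFull val) : Nonempty C := by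
  obtain ⟨a, -⟩ := hf ⊤
  exact ⟨a⟩

end DLS

open FirstOrder FirstOrder.Language Cardinal
open BVal
namespace DLS

/-! ### A closure lemma -/

theorem closure_lemma {X : Type} {μ : Cardinal.{0}} (hμ : ℵ₀ ≤ μ) (Step : Set X → Set X)
    (hS : ∀ Y : Set X, #Y ≤ μ → #(Step Y) ≤ μ) (Y0 : Set X) (hY0 : #Y0 ≤ μ) :
    ∃ Y : Set X, Y0 ⊆ Y ∧ #Y ≤ μ ∧ ∀ A : Set X, A ⊆ Y → #A < μ.ord.cof →
      ∃ Y1 : Set X, Y1 ⊆ Y ∧ A ⊆ Y1 ∧ Step Y1 ⊆ Y := by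
  classical
  let W := μ.ord.ToType
  have hW : #W = μ := Cardinal.mk_ord_toType μ
  have wf : WellFounded ((· < ·) : W → W → Prop) := wellFounded_lt
  let S : W → Set X := wf.fix fun i ih => Y0 ∪ ⋃ j : {j // j < i}, (ih j.1 j.2 ∪ Step (ih j.1 j.2))
  have hSeq : ∀ i, S i = Y0 ∪ ⋃ j : {j // j < i}, (S j.1 ∪ Step (S j.1)) := fun i => wf.fix_eq _ i
  have hun : ∀ (J : Type) (_ : #J ≤ μ) (f : J → Set X), (∀ j, #(f j) ≤ μ) → #(⋃ j, f j) ≤ μ := by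
    intro J hJ f hf
    refine (mk_iUnion_le f).trans ?_
    refine (mul_le_mul' hJ (ciSup_le' hf)).trans ?_
    rw [mul_eq_self hμ]
  have hun2 : ∀ a b : Set X, #a ≤ μ → #b ≤ μ → #(a ∪ b : Set X) ≤ μ := by
    intro a b ha hb
    exact (mk_union_le a b).trans (add_le_of_le hμ ha hb)
  have hcard : ∀ i, #(S i) ≤ μ := by
    intro i
    induction i using wf.induction with
    | _ i ih =>
      rw [hSeq]
      refine hun2 _ _ hY0 (hun _ ((mk_subtype_le _).trans hW.le) _ ?_)
      rintro ⟨j, hj⟩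
      exact hun2 _ _ (ih j hj) (hS _ (ih j hj))
  have hlt : ∀ i j, j < i → S j ⊆ S i ∧ Step (S j) ⊆ S i := by
    intro i j hj
    rw [hSeq i]
    constructor
    · intro x hx
      exact Or.inr (Set.mem_iUnion.2 ⟨⟨j, hj⟩, Or.inl hx⟩)
    · intro x hx
      exact Or.inr (Set.mem_iUnion.2 ⟨⟨j, hj⟩, Or.inr hx⟩)
  have hlim : Order.IsSuccLimit μ.ord := isSuccLimit_ord hμ
  have hne : Nonempty W := by
    rw [← mk_ne_zero_iff, hW]
    exact (aleph0_pos.trans_le hμ).ne'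
  have hcof : ∀ A : Set W, #A < μ.ord.cof → ∃ x, ∀ y ∈ A, y < x := by
    intro A hA
    rw [← not_isCofinal_iff]
    intro hc
    have := Order.cof_le hc
    rw [Ordinal.cof_toType] at this
    exact absurd hA (not_lt.2 this)
  have hsucc : ∀ i : W, ∃ x, i < x := by
    intro i
    obtain ⟨x, hx⟩ := hcof {i} (by
      rw [mk_singleton]
      exact one_lt_aleph0.trans_le (Ordinal.aleph0_le_cof.2 hlim))
    exact ⟨x, hx i rfl⟩
  refine ⟨⋃ i, S i, ?_, hun _ hW.le _ hcard, ?_⟩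
  · intro x hx
    refine Set.mem_iUnion.2 ⟨hne.some, ?_⟩
    rw [hSeq]
    exact Or.inl hx
  · intro A hA hAc
    have : ∀ a : A, ∃ i, (a : X) ∈ S i := fun a => Set.mem_iUnion.1 (hA a.2)
    choose f hf using this
    obtain ⟨x, hx⟩ := hcof (Set.range f) (mk_range_le.trans_lt hAc)
    obtain ⟨y, hy⟩ := hsucc x
    refine ⟨S x, Set.subset_iUnion S x, ?_, (hlt y x hy).2.trans (Set.subset_iUnion S y)⟩
    intro a ha
    exact (hlt x _ (hx _ ⟨⟨a, ha⟩, rfl⟩)).1 (hf ⟨a, ha⟩)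

end DLS

open FirstOrder FirstOrder.Language Cardinal
open BVal
namespace DLS

/-! ### Power models, quotients, downward Löwenheim–Skolem -/

/-- Boolean homomorphisms from a power set algebra. -/
def IsHom {B Ω : Type} [CompleteBooleanAlgebra B] (F : Set Ω → B) : Prop :=
  (∀ a b, F (a ⊓ b) = F a ⊓ F b) ∧ (∀ a, F aᶜ = (F a)ᶜ) ∧ F ⊤ = ⊤ ∧ Monotone F

/-- The evaluation on a family of `N`-valued functions. -/
def pval {B Ω : Type} (F : Set Ω → B) (L : FirstOrder.Language.{0, 0}) {N D : Type} [L.Structure N]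
    (ev : D → Ω → N) : L.Formula D → B := fun φ => F {ω | φ.Realize fun d => ev d ω}

theorem pval_hv {B Ω : Type} [CompleteBooleanAlgebra B] {F : Set Ω → B} (hF : IsHom F)
    {L : FirstOrder.Language.{0, 0}} {N D : Type} [L.Structure N] [Nonempty N] (ev : D → Ω → N) :
    HV (pval F L ev) := by
  refine ⟨?_, ?_, ?_⟩
  · intro φ hφ
    rw [pval, ← hF.2.2.1]
    congr 1
    ext ω
    simp only [Set.mem_ofPred_eq, Set.top_eq_univ, Set.mem_univ, iff_true]
    exact hφ N _
  · intro φ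
    rw [pval, pval, ← hF.2.1]
    congr 1
  · intro φ ψ
    rw [pval, pval, pval, ← hF.1]
    congr 1
    ext ω
    simp only [Set.mem_ofPred_eq, Formula.realize_inf, Set.inf_eq_inter, Set.mem_inter_iff]

theorem pval_models {B Ω : Type} [CompleteBooleanAlgebra B] {F : Set Ω → B} (hF : IsHom F)
    {L : FirstOrder.Language.{0, 0}} {T : L.Theory} {N D : Type} [L.Structure N] [Nonempty N]
    (hN : N ⊨ T) (ev : D → Ω → N) : BModels (pval F L ev) T := by
  intro φ hφ
  rw [pval, ← hF.2.2.1]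
  congr 1
  ext ω
  simp only [Set.mem_ofPred_eq, Set.top_eq_univ, Set.mem_univ, iff_true]
  rw [Formula.realize_relabel]
  have := hN.realize_of_mem φ hφ
  rw [Sentence.Realize] at this
  convert this

theorem pval_full {B Ω : Type} [CompleteBooleanAlgebra B] {F : Set Ω → B}
    {L : FirstOrder.Language.{0, 0}} {N : Type} [L.Structure N] [Nonempty N] :
    IsFull (pval F L (fun (x : Ω → N) ω => x ω)) := by
  classical
  intro φ
  have : ∀ ω, ∃ x : N, (∃ y : N, φ.Realize (fun d : Ω → N => d ω) (fun _ => y)) →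
      φ.Realize (fun d : Ω → N => d ω) (fun _ => x) := by
    intro ω
    by_cases h : ∃ y : N, φ.Realize (fun d : Ω → N => d ω) (fun _ => y)
    · obtain ⟨y, hy⟩ := h
      exact ⟨y, fun _ => hy⟩
    · exact ⟨Classical.arbitrary N, fun h' => absurd h' h⟩
  choose a ha using this
  refine ⟨a, ?_⟩
  rw [pval, pval]
  congr 1
  ext ω
  simp only [Set.mem_ofPred_eq]
  rw [realize_ex1, realize_plug]
  exact ⟨ha ω, fun h => ⟨_, h⟩⟩

theorem hv_congr_val {B : Type} [CompleteBooleanAlgebra B] {L : FirstOrder.Language.{0, 0}}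
    {C D : Type} {val : L.Formula C → B} (h : HV val) (f g : D → C)
    (hfg : ∀ d, val (Term.equal (Term.var (f d)) (Term.var (g d))) = ⊤) (φ : L.Formula D) :
    val (φ.relabel f) = val (φ.relabel g) := by
  classical
  have key : ∀ f g : D → C, (∀ d, val (Term.equal (Term.var (f d)) (Term.var (g d))) = ⊤) →
      val (φ.relabel f) ≤ val (φ.relabel g) := by
    intro f g hfg
    have h1 : val (fconj φ.freeVarFinset
        fun d => (Term.equal (Term.var (f d)) (Term.var (g d)) : L.Formula C)) = ⊤ := by
      rw [h.fconj]
      simp [hfg]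
    have h2 : val (φ.relabel f ⊓ fconj φ.freeVarFinset
        fun d => (Term.equal (Term.var (f d)) (Term.var (g d)) : L.Formula C)) ≤
        val (φ.relabel g) := by
      refine h.mono fun N _ _ v => ?_
      rw [Formula.realize_inf, realize_fconj, Formula.realize_relabel, Formula.realize_relabel]
      rintro ⟨h3, h4⟩
      refine (realize_congr_fv φ ?_).1 h3
      intro c hc
      have := h4 c hc
      rw [Formula.realize_equal] at this
      simpa using this
    rw [h.2.2, h1, inf_top_eq] at h2
    exact h2
  refine le_antisymm (key f g hfg) (key g f fun d => ?_)
  rw [← hfg d]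
  refine h.congr fun N _ _ v => ?_
  simp only [Formula.realize_equal, Term.realize_var]
  exact eq_comm

/-- A bounded formula in one variable as a formula over `C ⊕ Unit`. -/
def toU {L : FirstOrder.Language.{0, 0}} {C : Type} (φ : L.BoundedFormula C 1) :
    L.Formula (C ⊕ Unit) := φ.toFormula.relabel (Sum.map id fun _ => ())

theorem realize_toU {L : FirstOrder.Language.{0, 0}} {C : Type} (φ : L.BoundedFormula C 1)
    {N : Type} [L.Structure N] (w : C ⊕ Unit → N) :
    (toU φ).Realize w ↔ φ.Realize (w ∘ Sum.inl) (fun _ => w (Sum.inr ())) := by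
  rw [toU, Formula.realize_relabel, BoundedFormula.realize_toFormula]
  rfl

/-- Realization of `iExs` over `Unit`. -/
theorem realize_exU {L : FirstOrder.Language.{0, 0}} {C : Type} (ψ : L.Formula (C ⊕ Unit))
    {N : Type} [L.Structure N] (w : C → N) :
    (ψ.iExs Unit).Realize w ↔ ∃ x : N, ψ.Realize (Sum.elim w fun _ => x) := by
  rw [Formula.realize_iExs]
  constructor
  · rintro ⟨i, hi⟩
    exact ⟨i (), hi⟩
  · rintro ⟨x, hx⟩
    exact ⟨fun _ => x, hx⟩

theorem realize_sub {L : FirstOrder.Language.{0, 0}} {C D : Type} (ψ : L.Formula (C ⊕ Unit))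
    (f : C → D) (a : D) {N : Type} [L.Structure N] (w : D → N) :
    (ψ.relabel (Sum.elim f fun _ => a)).Realize w ↔
      ψ.Realize (Sum.elim (w ∘ f) fun _ => w a) := by
  rw [Formula.realize_relabel]
  have : Sum.elim (w ∘ f) (fun _ : Unit => w a) = w ∘ Sum.elim f (fun _ => a) := by
    funext c; rcases c with c | c <;> rfl
  rw [this]

theorem realize_exU_map {L : FirstOrder.Language.{0, 0}} {C D : Type} (ψ : L.Formula (C ⊕ Unit))
    (f : C → D) {N : Type} [L.Structure N] (w : D → N) :
    ((ψ.relabel (Sum.map f id)).iExs Unit).Realize w ↔ (ψ.iExs Unit).Realize (w ∘ f) := by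
  rw [realize_exU, realize_exU]
  refine exists_congr fun x => ?_
  rw [Formula.realize_relabel]
  have : Sum.elim (w ∘ f) (fun _ : Unit => x) = Sum.elim w (fun _ => x) ∘ Sum.map f id := by
    funext c; rcases c with c | c <;> rfl
  rw [this]

/-- It suffices to check fullness for formulas in `C ⊕ Unit`. -/
theorem full_of_unit {B : Type} [CompleteBooleanAlgebra B] {L : FirstOrder.Language.{0, 0}}
    {C : Type} {val : L.Formula C → B} (h : HV val)
    (hf : ∀ ψ : L.Formula (C ⊕ Unit),
      ∃ a : C, val (ψ.iExs Unit) = val (ψ.relabel (Sum.elim id fun _ => a))) : IsFull val := by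
  intro φ
  obtain ⟨a, ha⟩ := hf (toU φ)
  refine ⟨a, ?_⟩
  trans val ((toU φ).iExs Unit)
  · refine h.congr fun N _ _ w => ?_
    rw [realize_ex1, realize_exU]
    refine exists_congr fun x => ?_
    rw [realize_toU]
    rfl
  · rw [ha]
    refine h.congr fun N _ _ w => ?_
    rw [realize_plug, realize_sub, realize_toU]
    rfl

theorem quot_norm {B : Type} [CompleteBooleanAlgebra B] {L : FirstOrder.Language.{0, 0}}
    {T : L.Theory} {X : Type} {val : L.Formula X → B} (h : HV val) (hf : IsFull val)
    (hm : BModels val T) : ∃ (C : Type) (val' : L.Formula C → B) (q : X → C),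
      Function.Surjective q ∧ (∀ φ : L.Formula X, val φ = val' (φ.relabel q)) ∧
      IsFullBModel T val' := by
  let s : Setoid X :=
    { r := fun a b => val (Term.equal (Term.var a) (Term.var b)) = ⊤
      iseqv := by
        refine ⟨?_, ?_, ?_⟩
        · intro a
          exact h.1 _ fun N _ _ v => by simp [Formula.realize_equal]
        · intro a b hab
          rw [← hab]
          refine h.congr fun N _ _ v => ?_
          simp only [Formula.realize_equal, Term.realize_var]
          exact eq_comm
        · intro a b c hab hbc
          have h2 : val ((Term.equal (Term.var a) (Term.var b) : L.Formula X) ⊓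
            (Term.equal (Term.var b) (Term.var c) : L.Formula X)) ≤
            val (Term.equal (Term.var a) (Term.var c)) := by
            refine h.mono fun N _ _ v => ?_
            simp only [Formula.realize_inf, Formula.realize_equal, Term.realize_var]
            rintro ⟨h1, h2⟩
            exact h1.trans h2
          rw [h.2.2, hab, hbc, inf_top_eq] at h2
          exact top_le_iff.1 h2 }
  let C := Quotient s
  let val' : L.Formula C → B := fun φ => val (φ.relabel Quotient.out)
  have hv' : HV val' := h.relabel _
  have hq : ∀ φ : L.Formula X, val φ = val' (φ.relabel (Quotient.mk s)) := by
    intro φ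
    change _ = val ((φ.relabel (Quotient.mk s)).relabel Quotient.out)
    rw [h.relabel_relabel, ← h.relabel_id φ]
    refine hv_congr_val h _ _ ?_ φ
    intro d
    exact s.symm (Quotient.mk_out (s := s) d)
  have hfull : IsFull val' := by
    refine full_of_unit hv' fun ψ => ?_
    obtain ⟨a, ha⟩ := full_unit h hf (ψ.relabel (Sum.map Quotient.out id))
    refine ⟨Quotient.mk s a, ?_⟩
    trans val ((ψ.relabel (Sum.map Quotient.out id)).iExs Unit)
    · refine h.congr fun N _ _ w => ?_
      rw [realize_exU_map, Formula.realize_relabel]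
    · rw [ha, hq]
      refine hv'.congr fun N _ _ w => ?_
      rw [realize_sub, Formula.realize_relabel, realize_sub, Formula.realize_relabel]
      have : Sum.elim ((w ∘ Quotient.mk s) ∘ id) (fun _ : Unit => (w ∘ Quotient.mk s) a) ∘
          Sum.map Quotient.out id = Sum.elim (w ∘ id) (fun _ => w (Quotient.mk s a)) := by
        funext c
        rcases c with c | c
        · simp
        · rfl
      rw [this]
  refine ⟨C, val', Quotient.mk s, Quotient.mk_surjective, hq, ?_, ?_, ?_⟩
  rotate_left
  · exact hfull
  · intro φ hφ
    rw [← hm φ hφ]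
    change val ((φ.relabel _).relabel Quotient.out) = _
    rw [h.relabel_relabel]
    congr 2
    ext e
    exact e.elim
  · refine hv'.isBVal hfull ?_
    intro a b hab
    have h1 : val (Term.equal (Term.var a.out) (Term.var b.out)) = ⊤ := by
      rw [← hab]
      refine h.congr fun N _ _ w => ?_
      rw [Formula.realize_relabel]
      simp [Formula.realize_equal]
    have h2 : s.r a.out b.out := h1
    rw [← a.out_eq, ← b.out_eq]
    exact Quotient.sound h2

end DLS

open FirstOrder FirstOrder.Language Cardinal
open BVal
namespace DLS

theorem card_formula_le {L : FirstOrder.Language.{0, 0}} (hL : L.card ≤ ℵ₀) {C : Type}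
    {κ : Cardinal.{0}} (hκ : ℵ₀ ≤ κ) (hC : #C ≤ κ) : #(L.Formula C) ≤ κ := by
  have h1 : #(L.Formula C) ≤ #(Σ n, L.BoundedFormula C n) :=
    mk_le_of_injective (f := fun φ : L.Formula C => (⟨0, φ⟩ : Σ n, L.BoundedFormula C n)) (by
      intro a b hab
      simpa using hab)
  refine h1.trans (BoundedFormula.card_le.trans ?_)
  simp only [lift_id]
  exact max_le hκ (add_le_of_le hκ hC (hL.trans hκ))

theorem bmodels_relabel {B : Type} [CompleteBooleanAlgebra B] {L : FirstOrder.Language.{0, 0}}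
    {T : L.Theory} {C D : Type} {val : L.Formula D → B} (h : HV val) (f : C → D) :
    BModels (fun φ : L.Formula C => val (φ.relabel f)) T ↔ BModels val T := by
  have : ∀ φ : L.Sentence, val ((φ.relabel (fun e : Empty => (e.elim : C)) : L.Formula C).relabel f) =
      val (Formula.relabel (fun e : Empty => e.elim) φ) := by
    intro φ
    rw [h.relabel_relabel]
    congr 2
    ext e
    exact e.elim
  constructor
  · intro h1 φ hφ
    rw [← this]
    exact h1 φ hφ
  · intro h1 φ hφ
    have := this φ
    change val _ = _
    rw [this]
    exact h1 φ hφ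

theorem exists_restrict {L : FirstOrder.Language.{0, 0}} {C D : Type} [DecidableEq D] (ι : C → D)
    (hι : Function.Injective ι) (ψ : L.Formula D) (hfv : ∀ d ∈ ψ.freeVarFinset, d ∈ Set.range ι) :
    ∃ ψ' : L.Formula C, ∀ (N : Type) [L.Structure N] [Nonempty N] (w : D → N),
      ψ.Realize w ↔ ψ'.Realize (w ∘ ι) := by
  obtain ⟨ψ', h1, h2⟩ := exists_proj ι hι ψ
  refine ⟨ψ', fun N _ _ w => ⟨h1 N w, fun h => ?_⟩⟩
  obtain ⟨w', hw, h'⟩ := h2 N _ h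
  refine (realize_congr_fv ψ ?_).1 h'
  intro c hc
  obtain ⟨x, rfl⟩ := hfv c hc
  exact congrFun hw x

/-- Downward Löwenheim–Skolem for full Boolean valued models. -/
theorem dls {B : Type} [CompleteBooleanAlgebra B] {L : FirstOrder.Language.{0, 0}}
    (hL : L.card ≤ ℵ₀) {T : L.Theory} {C : Type} {val : L.Formula C → B} (h : IsFullBModel T val)
    {κ : Cardinal.{0}} (hκ : ℵ₀ ≤ κ) (A : Set C) (hA : #A ≤ κ) :
    ∃ Y : Set C, A ⊆ Y ∧ #Y ≤ κ ∧
      IsFullBModel T (fun φ : L.Formula Y => val (φ.relabel Subtype.val)) := by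
  classical
  have hv := IsBVal.hv h.1
  choose wit hwit using full_unit hv h.2.1
  let Step : Set C → Set C := fun Y =>
    Set.range fun ψ : L.Formula (Y ⊕ Unit) => wit (ψ.relabel (Sum.map Subtype.val id))
  obtain ⟨Y, hAY, hYκ, hY⟩ := closure_lemma hκ Step (by
    intro Y hY
    refine mk_range_le.trans (card_formula_le hL hκ ?_)
    simp only [mk_sum, lift_id, mk_fintype, Fintype.card_unit, Nat.cast_one]
    exact add_le_of_le hκ hY (one_le_aleph0.trans hκ)) A hA
  have hvY : HV (fun φ : L.Formula Y => val (φ.relabel Subtype.val)) := hv.relabel _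
  have hfull : IsFull (fun φ : L.Formula Y => val (φ.relabel Subtype.val)) := by
    refine full_of_unit hvY fun ψ => ?_
    let A0 : Set C := {c | ∃ y ∈ ψ.freeVarFinset, ∃ z : Y, y = Sum.inl z ∧ (z : C) = c}
    have hA0 : A0.Finite := by
      refine (ψ.freeVarFinset.finite_toSet.image
        (Sum.elim (fun z : Y => (z : C)) fun _ => (full_nonempty h.2.1).some)).subset ?_
      rintro c ⟨y, hy, z, rfl, rfl⟩
      exact ⟨_, hy, rfl⟩
    obtain ⟨Y1, hY1, hAY1, hst⟩ := hY A0 (by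
      rintro c ⟨y, hy, z, rfl, rfl⟩
      exact z.2) (by
      refine lt_of_lt_of_le hA0.lt_aleph0 ?_
      exact Ordinal.aleph0_le_cof.2 (isSuccLimit_ord hκ))
    obtain ⟨ψ1, hψ1⟩ := exists_restrict (Sum.map (Set.inclusion hY1) (id : Unit → Unit))
      ((Set.inclusion_injective hY1).sumMap Function.injective_id) ψ (by
        rintro (d | d) hd
        · exact ⟨Sum.inl ⟨d, hAY1 ⟨_, hd, d, rfl, rfl⟩⟩, rfl⟩
        · exact ⟨Sum.inr d, rfl⟩)
    have hmem : wit (ψ1.relabel (Sum.map Subtype.val id)) ∈ Y := hst ⟨ψ1, rfl⟩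
    refine ⟨⟨_, hmem⟩, ?_⟩
    have h1 := hwit (ψ1.relabel (Sum.map Subtype.val id))
    trans val ((ψ1.relabel (Sum.map Subtype.val id)).iExs Unit)
    · refine hv.congr fun N _ _ w => ?_
      rw [Formula.realize_relabel, realize_exU_map, realize_exU, realize_exU]
      refine exists_congr fun x => ?_
      rw [hψ1]
      have : Sum.elim (w ∘ Subtype.val) (fun _ : Unit => x) ∘ Sum.map (Set.inclusion hY1) id =
        Sum.elim (w ∘ Subtype.val) (fun _ => x) := by
        funext c; rcases c with c | c <;> rfl
      rw [this]
    · rw [h1]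
      refine hv.congr fun N _ _ w => ?_
      rw [realize_sub, Formula.realize_relabel, Formula.realize_relabel, realize_sub, hψ1]
      refine iff_of_eq ?_
      congr 1
      funext c; rcases c with c | c <;> rfl
  refine ⟨Y, hAY, hYκ, hvY.isBVal hfull ?_, hfull, (bmodels_relabel hv _).2 h.2.2⟩
  intro a b hab
  apply Subtype.ext
  apply IsBVal.distinct h.1
  rw [← hab]
  refine hv.congr fun N _ _ w => ?_
  rw [Formula.realize_relabel]
  simp [Formula.realize_equal]

/-- The realization lemma. -/
theorem realization {B : Type} [CompleteBooleanAlgebra B] {L : FirstOrder.Language.{0, 0}}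
    (hL : L.card ≤ ℵ₀) {T : L.Theory} {N : Type} [L.Structure N] [Nonempty N] (hN : N ⊨ T)
    {Ω D : Type} {F : Set Ω → B} (hF : IsHom F) (ev : D → Ω → N)
    {κ : Cardinal.{0}} (hκ : ℵ₀ ≤ κ) (hD : #D ≤ κ) :
    ∃ (C : Type) (v : L.Formula C → B) (q : D → C), #C ≤ κ ∧ IsFullBModel T v ∧
      ∀ φ : L.Formula D, v (φ.relabel q) = F {ω | φ.Realize fun d => ev d ω} := by
  obtain ⟨C, v, q, hq, hvq, hm⟩ := quot_norm (pval_hv hF (fun (x : Ω → N) ω => x ω))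
    (pval_full (F := F) (L := L)) (pval_models (T := T) hF hN _)
  obtain ⟨Y, hY, hYκ, hYm⟩ := dls hL hm hκ (Set.range (q ∘ ev)) (mk_range_le.trans hD)
  refine ⟨Y, _, fun d => ⟨q (ev d), hY ⟨d, rfl⟩⟩, hYκ, hYm, ?_⟩
  intro φ
  have hv := IsBVal.hv hm.1
  change v _ = _
  rw [hv.relabel_relabel]
  have h1 := hvq (φ.relabel ev)
  rw [hv.relabel_relabel] at h1
  refine Eq.trans h1.symm ?_
  rw [pval]
  congr 1
  ext ω
  simp only [Set.mem_ofPred_eq, Formula.realize_relabel]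
  rfl

end DLS

open FirstOrder FirstOrder.Language Cardinal
open BVal
namespace DLS

/-! ### Extension lemmas -/

open Classical in
/-- The literal of `φ` chosen by the ultrafilter `u`. -/
noncomputable def lit {B : Type} {L : FirstOrder.Language.{0, 0}} {C : Type}
    (v : L.Formula C → B) (u : Set B) (φ : L.Formula C) : L.Formula C :=
  if v φ ∈ u then φ else φ.not

theorem lit_mem {B : Type} [CompleteBooleanAlgebra B] {L : FirstOrder.Language.{0, 0}} {C : Type}
    {v : L.Formula C → B} (h : HV v) {u : Set B} (hu : IsBUltrafilter u) (φ : L.Formula C) :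
    v (lit v u φ) ∈ u := by
  unfold lit
  split_ifs with h1
  · exact h1
  · rw [h.2.1, buf_compl hu]
    exact h1

theorem realize_lit {B : Type} {L : FirstOrder.Language.{0, 0}} {C : Type}
    {v : L.Formula C → B} {u : Set B} {φ : L.Formula C} {N : Type} [L.Structure N] {w : C → N}
    (h : (lit v u φ).Realize w) : φ.Realize w ↔ v φ ∈ u := by
  unfold lit at h
  split_ifs at h with h1
  · exact ⟨fun _ => h1, fun _ => h⟩
  · rw [Formula.realize_not] at h
    exact ⟨fun h' => absurd h' h, fun h' => absurd h' h1⟩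

theorem exists_real_u {B : Type} [CompleteBooleanAlgebra B] {L : FirstOrder.Language.{0, 0}}
    {T : L.Theory} (hT : T.IsComplete) {N : Type} [L.Structure N] [Nonempty N] (hN : N ⊨ T)
    {C : Type} {v : L.Formula C → B} (h : HV v) (hm : BModels v T) {u : Set B}
    (hu : IsBUltrafilter u) (s : Finset (L.Formula C)) {θ : L.Formula C} (hθ : v θ ∈ u) :
    ∃ w : C → N, θ.Realize w ∧ ∀ φ ∈ s, (φ.Realize w ↔ v φ ∈ u) := by
  have h1 : v (θ ⊓ fconj s (lit v u)) ∈ u := by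
    rw [h.2.2, buf_inf hu, h.fconj, buf_finset_inf hu]
    exact ⟨hθ, fun φ _ => lit_mem h hu φ⟩
  obtain ⟨w, hw⟩ := exists_real hT hN h hm (buf_ne_bot hu h1)
  rw [Formula.realize_inf, realize_fconj] at hw
  exact ⟨w, hw.1, fun φ hφ => realize_lit (hw.2 φ hφ)⟩

theorem exists_model {L : FirstOrder.Language.{0, 0}} {T : L.Theory} (hT : T.IsComplete) :
    ∃ N : OrdStructure L, N.carrier ⊨ T := by
  obtain ⟨N⟩ := hT.1
  exact ⟨⟨N⟩, N.is_model⟩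

theorem one_ext {B : Type} [CompleteBooleanAlgebra B] {L : FirstOrder.Language.{0, 0}}
    (hL : L.card ≤ ℵ₀) {T : L.Theory} (hT : T.IsComplete) {C : Type} {v : L.Formula C → B}
    (h : IsFullBModel T v) {κ : Cardinal.{0}} (hκ : ℵ₀ ≤ κ) (hC : #C ≤ κ) {I : Type}
    (χ : I → L.Formula (C ⊕ Unit)) (g : I → B)
    (hg : ∀ s : Finset I, s.inf g ≤ v ((fconj s χ).iExs Unit)) :
    ∃ (C1 : Type) (v1 : L.Formula C1 → B) (ι : C → C1) (c : C1), #C1 ≤ κ ∧ IsFullBModel T v1 ∧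
      ElemMap v v1 ι ∧ ∀ i, g i ≤ v1 ((χ i).relabel (Sum.elim ι fun _ => c)) := by
  classical
  obtain ⟨⟨N⟩, hN⟩ := exists_model hT
  have hv := IsBVal.hv h.1
  let Ω := {ω : (C ⊕ Unit → N) × (I → Prop) // ∀ i, ω.2 i → (χ i).Realize ω.1}
  let R : L.Formula C ⊕ I → Set Ω := Sum.elim (fun φ => {ω | φ.Realize (ω.1.1 ∘ Sum.inl)})
    (fun i => {ω | ω.1.2 i})
  obtain ⟨F, hFR, hF⟩ := sikorski_family R (Sum.elim v g) (by
    intro u hu s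
    let si := s.toRight.filter fun i => g i ∈ u
    obtain ⟨w, hw1, hw2⟩ := exists_real_u hT hN hv h.2.2 hu s.toLeft
      (θ := (fconj si χ).iExs Unit) (buf_mono hu ((buf_finset_inf hu si g).2 (by
        intro i hi
        exact (Finset.mem_filter.1 hi).2)) (hg si))
    rw [realize_exU] at hw1
    obtain ⟨x, hx⟩ := hw1
    rw [realize_fconj] at hx
    refine ⟨⟨(Sum.elim w fun _ => x, fun i => i ∈ si), hx⟩, ?_⟩
    rintro (φ | i) hi
    · exact hw2 φ (by simpa using hi)
    · change i ∈ si ↔ g i ∈ u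
      simp only [si, Finset.mem_filter, Finset.mem_toRight]
      exact ⟨fun h => h.2, fun h => ⟨hi, h⟩⟩)
  obtain ⟨C1, v1, q, hC1, hm1, hq⟩ := realization hL hN (F := F) hF
    (fun (d : C ⊕ Unit) (ω : Ω) => ω.1.1 d) hκ (by
      simp only [mk_sum, lift_id, mk_fintype, Fintype.card_unit, Nat.cast_one]
      exact add_le_of_le hκ hC (one_le_aleph0.trans hκ))
  have hv1 := IsBVal.hv hm1.1
  refine ⟨C1, v1, q ∘ Sum.inl, q (Sum.inr ()), hC1, hm1, ?_, ?_⟩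
  · intro φ
    rw [← hv1.relabel_relabel, hq]
    refine (hFR (Sum.inl φ)).symm.trans ?_
    congr 1
    ext ω
    simp only [Set.mem_ofPred_eq, Formula.realize_relabel]
    rfl
  · intro i
    have e : (Sum.elim (q ∘ Sum.inl) fun _ => q (Sum.inr ())) = q := by
      funext c; rcases c with c | c <;> rfl
    rw [e, hq]
    refine (hFR (Sum.inr i)).symm.le.trans (hF.2.2.2 ?_)
    intro ω hω
    exact ω.2 i hω

theorem amalg {B : Type} [CompleteBooleanAlgebra B] {L : FirstOrder.Language.{0, 0}}
    (hL : L.card ≤ ℵ₀) {T : L.Theory} (hT : T.IsComplete) {Y : Type} {v : L.Formula Y → B}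
    (h : IsFullBModel T v) {κ : Cardinal.{0}} (hκ : ℵ₀ ≤ κ) (hY : #Y ≤ κ) {J Λ : Type}
    (hJ : #J ≤ κ) (hΛ : #Λ ≤ κ) (vj : J → L.Formula Λ → B) (hvj : ∀ j, HV (vj j))
    (t : J → Set Λ) (f : J → Λ → Y)
    (hcomp : ∀ j, ∀ φ : L.Formula (t j),
      vj j (φ.relabel Subtype.val) = v (φ.relabel (f j ∘ Subtype.val))) :
    ∃ (C' : Type) (v' : L.Formula C' → B) (ι : Y → C') (g : J → Λ → C'), #C' ≤ κ ∧
      IsFullBModel T v' ∧ ElemMap v v' ι ∧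
      ∀ j, ElemMap (vj j) v' (g j) ∧ ∀ x ∈ t j, g j x = ι (f j x) := by
  classical
  obtain ⟨⟨N⟩, hN⟩ := exists_model hT
  have hv := IsBVal.hv h.1
  let Ω := {w : (Y ⊕ J × Λ) → N // ∀ j, ∀ x ∈ t j, w (Sum.inr (j, x)) = w (Sum.inl (f j x))}
  let R : L.Formula Y ⊕ J × L.Formula Λ → Set Ω :=
    Sum.elim (fun φ => {ω | φ.Realize (ω.1 ∘ Sum.inl)})
      (fun p => {ω | p.2.Realize fun x => ω.1 (Sum.inr (p.1, x))})
  obtain ⟨F, hFR, hF⟩ := sikorski_family R (Sum.elim v fun p => vj p.1 p.2) (by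
    intro u hu s
    let θ : J → L.Formula Λ := fun j =>
      fconj (s.toRight.filter fun p => p.1 = j) fun p => lit (vj j) u p.2
    have hθ : ∀ j, vj j (θ j) ∈ u := by
      intro j
      rw [(hvj j).fconj, buf_finset_inf hu]
      exact fun p _ => lit_mem (hvj j) hu p.2
    choose θ' hθ1 hθ2 using fun j => exists_proj (Subtype.val : t j → Λ)
      Subtype.val_injective (θ j)
    have hθ' : ∀ j, v ((θ' j).relabel (f j ∘ Subtype.val)) ∈ u := by
      intro j
      rw [← hcomp]
      refine buf_mono hu (hθ j) ((hvj j).mono fun N _ _ w hw => ?_)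
      rw [Formula.realize_relabel]
      exact hθ1 j N w hw
    let Js := s.toRight.image Prod.fst
    obtain ⟨w0, hw1, hw2⟩ := exists_real_u hT hN hv h.2.2 hu s.toLeft
      (θ := fconj Js fun j => (θ' j).relabel (f j ∘ Subtype.val)) (by
        rw [hv.fconj, buf_finset_inf hu]
        exact fun j _ => hθ' j)
    rw [realize_fconj] at hw1
    have hw : ∀ j, ∃ w : Λ → N, (∀ x ∈ t j, w x = w0 (f j x)) ∧ (j ∈ Js → (θ j).Realize w) := by
      intro j
      by_cases hj : j ∈ Js
      · have := hw1 j hj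
        rw [Formula.realize_relabel] at this
        obtain ⟨w, e, hw⟩ := hθ2 j N _ this
        exact ⟨w, fun x hx => congrFun e ⟨x, hx⟩, fun _ => hw⟩
      · exact ⟨w0 ∘ f j, fun x _ => rfl, fun h => absurd h hj⟩
    choose w hwt hwθ using hw
    refine ⟨⟨Sum.elim w0 fun p => w p.1 p.2, fun j x hx => hwt j x hx⟩, ?_⟩
    rintro (φ | ⟨j, φ⟩) hi
    · exact hw2 φ (by simpa using hi)
    · have hi' : (j, φ) ∈ s.toRight := by simpa using hi
      have := hwθ j (Finset.mem_image.2 ⟨(j, φ), hi', rfl⟩)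
      rw [realize_fconj] at this
      exact realize_lit (this (j, φ) (Finset.mem_filter.2 ⟨hi', rfl⟩)))
  obtain ⟨C', v', q, hC', hm', hq⟩ := realization hL hN (F := F) hF
    (fun (d : Y ⊕ J × Λ) (ω : Ω) => ω.1 d) hκ (by
      simp only [mk_sum, lift_id, mk_prod]
      exact add_le_of_le hκ hY (mul_le_of_le hκ hJ hΛ))
  have hv' := IsBVal.hv hm'.1
  refine ⟨C', v', q ∘ Sum.inl, fun j x => q (Sum.inr (j, x)), hC', hm', ?_, ?_⟩
  · intro φ
    rw [← hv'.relabel_relabel, hq]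
    refine (hFR (Sum.inl φ)).symm.trans ?_
    congr 1
    ext ω
    simp only [Set.mem_ofPred_eq, Formula.realize_relabel]
    rfl
  · intro j
    refine ⟨?_, ?_⟩
    · intro φ
      have := hv'.relabel_relabel (fun x : Λ => (Sum.inr (j, x) : Y ⊕ J × Λ)) q φ
      refine Eq.trans ?_ this
      rw [hq]
      refine (hFR (Sum.inr (j, φ))).symm.trans ?_
      congr 1
      ext ω
      simp only [Set.mem_ofPred_eq, Formula.realize_relabel]
      rfl
    · intro x hx
      apply IsBVal.distinct hm'.1
      have h1 := hq (Term.equal (Term.var (Sum.inr (j, x))) (Term.var (Sum.inl (f j x))))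
      have h2 : {ω : Ω | (Term.equal (Term.var (Sum.inr (j, x))) (Term.var (Sum.inl (f j x))) :
          L.Formula (Y ⊕ J × Λ)).Realize fun d => ω.1 d} = ⊤ := by
        ext ω
        simp only [Set.mem_ofPred_eq, Set.top_eq_univ, Set.mem_univ, iff_true,
          Formula.realize_equal, Term.realize_var]
        exact ω.2 j x hx
      rw [h2, hF.2.2.1] at h1
      rw [← h1]
      refine hv'.congr fun N _ _ w => ?_
      rw [Formula.realize_relabel]
      simp [Formula.realize_equal]

end DLS

open FirstOrder FirstOrder.Language Cardinal
open BVal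
namespace DLS

/-! ### Saturated extensions -/

theorem ElemMap.comp {B : Type} [CompleteBooleanAlgebra B] {L : FirstOrder.Language.{0, 0}}
    {C D E : Type} {u : L.Formula C → B} {v : L.Formula D → B} {w : L.Formula E → B} (hw : HV w)
    {f : C → D} {g : D → E} (hf : ElemMap u v f) (hg : ElemMap v w g) : ElemMap u w (g ∘ f) := by
  intro φ
  rw [hf φ, hg, hw.relabel_relabel]

/-- All `lam`-small extension problems over `v` are solved in `v'`. -/
def Solves {B : Type} [CompleteBooleanAlgebra B] {L : FirstOrder.Language.{0, 0}} (T : L.Theory)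
    (lam : Cardinal.{0}) {Y Y' : Type} (v : L.Formula Y → B) (v' : L.Formula Y' → B)
    (k : Y → Y') : Prop :=
  ∀ (C0 C1 : Type) (v0 : L.Formula C0 → B) (v1 : L.Formula C1 → B),
    IsFullBModel T v0 → IsFullBModel T v1 → #C1 ≤ lam →
    ∀ ι : C0 → C1, ElemMap v0 v1 ι →
    ∀ f : C0 → Y, ElemMap v0 v f →
    ∃ g : C1 → Y', ElemMap v1 v' g ∧ g ∘ ι = k ∘ f

theorem solve_step {B : Type} [CompleteBooleanAlgebra B] {L : FirstOrder.Language.{0, 0}}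
    (hL : L.card ≤ ℵ₀) {T : L.Theory} (hT : T.IsComplete) {Y : Type} {v : L.Formula Y → B}
    (h : IsFullBModel T v) {lam κ : Cardinal.{0}} (hlam : ℵ₀ ≤ lam) (hκ : ℵ₀ ≤ κ) (hY : #Y ≤ κ)
    (hB : #B ≤ κ) (hlk : lam ≤ κ) (hpow : κ ^ lam ≤ κ) :
    ∃ (Y' : Type) (v' : L.Formula Y' → B) (k : Y → Y'), #Y' ≤ κ ∧ IsFullBModel T v' ∧
      ElemMap v v' k ∧ Solves T lam v v' k := by
  classical
  have hv := IsBVal.hv h.1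
  let Λ : Type := Quotient.out lam
  have hΛ : #Λ = lam := mk_out lam
  let J := {p : (L.Formula Λ → B) × Set Λ × (Λ → Y) // HV p.1 ∧ ∀ φ : L.Formula p.2.1,
    p.1 (φ.relabel Subtype.val) = v (φ.relabel (p.2.2 ∘ Subtype.val))}
  have hκ0 : κ ≠ 0 := (aleph0_pos.trans_le hκ).ne'
  have hJ : #J ≤ κ := by
    refine (mk_subtype_le _).trans ?_
    simp only [mk_prod, lift_id]
    refine mul_le_of_le hκ ?_ (mul_le_of_le hκ ?_ ?_)
    · rw [← power_def]
      refine (power_le_power_right hB).trans ((power_le_power_left hκ0 ?_).trans hpow)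
      exact card_formula_le hL hlam hΛ.le
    · rw [mk_set, hΛ]
      refine (power_le_power_right ?_).trans hpow
      exact (nat_lt_aleph0 2).le.trans hκ
    · rw [← power_def, hΛ]
      exact (power_le_power_right hY).trans hpow
  obtain ⟨C', v', k, g, hC', hm', hk, hg⟩ := amalg hL hT h hκ hY hJ (hΛ.le.trans hlk)
    (fun j : J => j.1.1) (fun j => j.2.1) (fun j => j.1.2.1) (fun j => j.1.2.2) (fun j => j.2.2)
  have hv' := IsBVal.hv hm'.1
  refine ⟨C', v', k, hC', hm', hk, ?_⟩
  intro C0 C1 v0 v1 hm0 hm1 hC1 ι hι f hf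
  have hv0 := IsBVal.hv hm0.1
  have hv1 := IsBVal.hv hm1.1
  have hιi := elem_injective hm0.1 hv1 hι
  have : Nonempty C1 := full_nonempty hm1.2.1
  have : Nonempty Y := full_nonempty h.2.1
  rw [← hΛ] at hC1
  obtain ⟨e⟩ := (Cardinal.le_def C1 Λ).1 hC1
  let r : Λ → C1 := Function.invFun e
  have hre : ∀ c, r (e c) = c := Function.leftInverse_invFun e.injective
  let fj : Λ → Y := Function.extend (e ∘ ι) f fun _ => Classical.arbitrary Y
  have hfj : ∀ c, fj (e (ι c)) = f c :=
    fun c => (e.injective.comp hιi).extend_apply f _ c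
  let t : Set Λ := Set.range (e ∘ ι)
  let j : J := ⟨(fun ψ => v1 (ψ.relabel r), t, fj), hv1.relabel r, by
    intro φ
    dsimp only
    have hk : ∀ x : t, ∃ c, e (ι c) = x := fun x => x.2
    choose k hk using hk
    have e1 : r ∘ Subtype.val = ι ∘ k := by
      funext x
      change r x = ι (k x)
      rw [← hk x, hre]
    have e2 : fj ∘ Subtype.val = f ∘ k := by
      funext x
      change fj x = f (k x)
      rw [← hk x, hfj]
    rw [hv1.relabel_relabel, e1, e2, ← hv1.relabel_relabel, ← hι, hf, hv.relabel_relabel]⟩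
  obtain ⟨hg1, hg2⟩ := hg j
  refine ⟨g j ∘ e, ?_, ?_⟩
  · intro φ
    rw [← hv'.relabel_relabel, ← hg1]
    change _ = v1 ((φ.relabel e).relabel r)
    rw [hv1.relabel_relabel]
    have : r ∘ e = id := funext hre
    rw [this, hv1.relabel_id]
  · funext c
    have := hg2 (e (ι c)) ⟨c, rfl⟩
    refine this.trans ?_
    change k (fj _) = _
    rw [hfj]
    rfl

theorem full_equiv {B : Type} [CompleteBooleanAlgebra B] {L : FirstOrder.Language.{0, 0}}
    {T : L.Theory} {C D : Type} {v : L.Formula C → B} (h : IsFullBModel T v) (e : C ≃ D) :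
    IsFullBModel T (fun φ : L.Formula D => v (φ.relabel e.symm)) := by
  have hv := IsBVal.hv h.1
  have hv' : HV (fun φ : L.Formula D => v (φ.relabel e.symm)) := hv.relabel _
  have hf : IsFull (fun φ : L.Formula D => v (φ.relabel e.symm)) := by
    refine full_of_unit hv' fun ψ => ?_
    obtain ⟨a, ha⟩ := full_unit hv h.2.1 (ψ.relabel (Sum.map e.symm id))
    refine ⟨e a, ?_⟩
    refine Eq.trans ?_ (ha.trans ?_)
    · refine hv.congr fun N _ _ w => ?_
      rw [realize_exU_map, Formula.realize_relabel]
    · refine hv.congr fun N _ _ w => ?_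
      rw [realize_sub, Formula.realize_relabel, Formula.realize_relabel, realize_sub]
      refine iff_of_eq ?_
      congr 1
      funext c
      rcases c with c | c
      · rfl
      · simp
  refine ⟨hv'.isBVal hf ?_, hf, (bmodels_relabel hv _).2 h.2.2⟩
  intro a b hab
  apply e.symm.injective
  apply IsBVal.distinct h.1
  rw [← hab]
  refine hv.congr fun N _ _ w => ?_
  rw [Formula.realize_relabel]
  simp [Formula.realize_equal]

theorem exists_embed {Z : Type} {κ : Cardinal.{0}} (hκ : ℵ₀ ≤ κ) (hZ : κ < #Z) (Y : Set Z)
    (hY : #Y ≤ κ) {C : Type} (hC : #C ≤ κ) (ι : Y → C) (hι : Function.Injective ι) :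
    ∃ k : C → Z, Function.Injective k ∧ ∀ y, k (ι y) = y := by
  classical
  have : Infinite Z := by
    rw [infinite_iff]
    exact hκ.trans hZ.le
  have h1 : #(Yᶜ : Set Z) = #Z := mk_compl_of_infinite Y (hY.trans_lt hZ)
  have h2 : #C ≤ #(Yᶜ : Set Z) := by
    rw [h1]
    exact hC.trans hZ.le
  obtain ⟨m⟩ := (Cardinal.le_def C (Yᶜ : Set Z)).1 h2
  let k : C → Z := Function.extend ι Subtype.val fun c => (m c : Z)
  have hk1 : ∀ y, k (ι y) = y := fun y => hι.extend_apply _ _ y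
  have hk2 : ∀ c, (¬ ∃ y, ι y = c) → k c = m c := fun c hc => Function.extend_apply' _ _ c hc
  refine ⟨k, ?_, hk1⟩
  intro a b hab
  by_cases ha : ∃ y, ι y = a <;> by_cases hb : ∃ y, ι y = b
  · obtain ⟨y, rfl⟩ := ha
    obtain ⟨z, rfl⟩ := hb
    rw [hk1, hk1] at hab
    rw [Subtype.ext hab]
  · obtain ⟨y, rfl⟩ := ha
    rw [hk1, hk2 b hb] at hab
    exact absurd (hab ▸ y.2) (m b).2
  · obtain ⟨z, rfl⟩ := hb
    rw [hk1, hk2 a ha] at hab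
    exact absurd (hab.symm ▸ z.2) (m a).2
  · rw [hk2 a ha, hk2 b hb] at hab
    exact m.injective (Subtype.ext hab)

/-- Realizing an abstract extension inside `Z`. -/
theorem embed_model {B : Type} [CompleteBooleanAlgebra B] {L : FirstOrder.Language.{0, 0}}
    {T : L.Theory} {Z : Type} {κ : Cardinal.{0}} (hκ : ℵ₀ ≤ κ) (hZ : κ < #Z) (Y : Set Z)
    (hY : #Y ≤ κ) {C : Type} (hC : #C ≤ κ) (ι : Y → C) (hι : Function.Injective ι)
    {v : L.Formula C → B} (h : IsFullBModel T v) :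
    ∃ (Y' : Set Z) (hYY : Y ⊆ Y') (v' : L.Formula Y' → B) (k : C → Y'), #Y' ≤ κ ∧
      IsFullBModel T v' ∧ ElemMap v v' k ∧ k ∘ ι = Set.inclusion hYY := by
  obtain ⟨k, hk, hkι⟩ := exists_embed hκ hZ Y hY hC ι hι
  let e : C ≃ Set.range k := Equiv.ofInjective k hk
  have hYY : Y ⊆ Set.range k := fun y hy => ⟨ι ⟨y, hy⟩, hkι ⟨y, hy⟩⟩
  refine ⟨Set.range k, hYY, _, e, mk_range_le.trans hC, full_equiv h e, ?_, ?_⟩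
  · intro φ
    have hv := IsBVal.hv h.1
    change _ = v ((φ.relabel e).relabel e.symm)
    rw [hv.relabel_relabel]
    have : e.symm ∘ e = id := by funext c; simp
    rw [this, hv.relabel_id]
  · funext y
    apply Subtype.ext
    exact hkι y

end DLS

open FirstOrder FirstOrder.Language Cardinal
open BVal
namespace DLS

theorem finite_in_chain {Z I : Type*} [Nonempty I] (Ys : I → Set Z)
    (htot : ∀ i j, Ys i ⊆ Ys j ∨ Ys j ⊆ Ys i) (s : Set Z) (hs : s.Finite)
    (hsub : s ⊆ ⋃ i, Ys i) : ∃ i, s ⊆ Ys i := by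
  induction s, hs using Set.Finite.induction_on with
  | empty => exact ⟨Classical.arbitrary I, Set.empty_subset _⟩
  | @insert a s _ _ ih =>
    obtain ⟨i, hi⟩ := ih ((Set.subset_insert a s).trans hsub)
    obtain ⟨j, hj⟩ := Set.mem_iUnion.1 (hsub (Set.mem_insert a s))
    rcases htot i j with h | h
    · exact ⟨j, Set.insert_subset hj (hi.trans h)⟩
    · exact ⟨i, Set.insert_subset (h hj) hi⟩

theorem union_model {B : Type} [CompleteBooleanAlgebra B] {L : FirstOrder.Language.{0, 0}}
    {T : L.Theory} {Z I : Type} [Nonempty I] (Ys : I → Set Z) (vs : ∀ i, L.Formula (Ys i) → B)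
    (hm : ∀ i, IsFullBModel T (vs i))
    (htot : ∀ i j, (∃ h : Ys i ⊆ Ys j, ElemMap (vs i) (vs j) (Set.inclusion h)) ∨
      (∃ h : Ys j ⊆ Ys i, ElemMap (vs j) (vs i) (Set.inclusion h))) :
    ∃ v : L.Formula (⋃ i, Ys i) → B, IsFullBModel T v ∧
      ∀ i, ElemMap (vs i) v (Set.inclusion (Set.subset_iUnion Ys i)) := by
  classical
  have htot' : ∀ i j, Ys i ⊆ Ys j ∨ Ys j ⊆ Ys i := fun i j =>
    (htot i j).imp (fun h => h.1) (fun h => h.1)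
  have hv := fun i => IsBVal.hv (hm i).1
  let S := ⋃ i, Ys i
  let inc : ∀ i, Ys i → S := fun i => Set.inclusion (Set.subset_iUnion Ys i)
  have hinc : ∀ i, Function.Injective (inc i) := fun i => Set.inclusion_injective _
  let Rep : L.Formula S → (Σ i, L.Formula (Ys i)) → Prop := fun φ p =>
    ∀ (N : Type) [L.Structure N] [Nonempty N] (w : S → N), φ.Realize w ↔ p.2.Realize (w ∘ inc p.1)
  have hfin : ∀ (s : Set S), s.Finite → ∃ i, ∀ x ∈ s, (x : Z) ∈ Ys i := by
    intro s hs
    obtain ⟨i, hi⟩ := finite_in_chain Ys htot' (Subtype.val '' s) (hs.image _) (by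
      rintro _ ⟨x, _, rfl⟩
      exact x.2)
    exact ⟨i, fun x hx => hi ⟨x, hx, rfl⟩⟩
  have hrep : ∀ φ, ∃ p, Rep φ p := by
    intro φ
    obtain ⟨i, hi⟩ := hfin φ.freeVarFinset φ.freeVarFinset.finite_toSet
    obtain ⟨ψ, hψ⟩ := exists_restrict (inc i) (hinc i) φ (by
      intro d hd
      exact ⟨⟨d, hi d hd⟩, rfl⟩)
    exact ⟨⟨i, ψ⟩, hψ⟩
  have hext : ∀ i (N : Type) [Nonempty N] (w : Ys i → N), ∃ w' : S → N, w' ∘ inc i = w := by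
    intro i N _ w
    refine ⟨Function.extend (inc i) w fun _ => Classical.arbitrary N, ?_⟩
    funext x
    exact (hinc i).extend_apply _ _ x
  have hmove : ∀ φ i (ψ : L.Formula (Ys i)) j (h : Ys i ⊆ Ys j), Rep φ ⟨i, ψ⟩ →
      Rep φ ⟨j, ψ.relabel (Set.inclusion h)⟩ := by
    intro φ i ψ j h hr N _ _ w
    rw [Formula.realize_relabel]
    exact hr N w
  have hsame : ∀ φ i (ψ ψ' : L.Formula (Ys i)), Rep φ ⟨i, ψ⟩ → Rep φ ⟨i, ψ'⟩ →
      vs i ψ = vs i ψ' := by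
    intro φ i ψ ψ' h1 h2
    refine (hv i).congr fun N _ _ w => ?_
    obtain ⟨w', rfl⟩ := hext i N w
    exact (h1 N w').symm.trans (h2 N w')
  have hwd : ∀ φ p p', Rep φ p → Rep φ p' → vs p.1 p.2 = vs p'.1 p'.2 := by
    have key : ∀ φ p p', Rep φ p → Rep φ p' →
        (∃ h : Ys p.1 ⊆ Ys p'.1, ElemMap (vs p.1) (vs p'.1) (Set.inclusion h)) →
        vs p.1 p.2 = vs p'.1 p'.2 := by
      rintro φ ⟨i, ψ⟩ ⟨j, ψ'⟩ h1 h2 ⟨h, he⟩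
      refine (he ψ).trans ?_
      exact hsame φ j _ _ (hmove φ i ψ j h h1) h2
    intro φ p p' h1 h2
    rcases htot p.1 p'.1 with h | h
    · exact key φ p p' h1 h2 h
    · exact (key φ p' p h2 h1 h).symm
  choose rep hrp using hrep
  let v : L.Formula S → B := fun φ => vs (rep φ).1 (rep φ).2
  have hvr : ∀ φ i (ψ : L.Formula (Ys i)), Rep φ ⟨i, ψ⟩ → v φ = vs i ψ :=
    fun φ i ψ h => hwd φ _ _ (hrp φ) h
  have hvv : HV v := by
    refine ⟨?_, ?_, ?_⟩
    · intro φ hφ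
      refine (hv _).1 _ fun N _ _ w => ?_
      obtain ⟨w', rfl⟩ := hext _ N w
      exact (hrp φ N w').1 (hφ N w')
    · intro φ
      rw [hvr φ.not (rep φ).1 (rep φ).2.not, (hv _).2.1]
      intro N _ _ w
      rw [Formula.realize_not, Formula.realize_not, hrp φ N w]
    · intro φ ψ
      have : ∃ i, ∃ φ' ψ' : L.Formula (Ys i), Rep φ ⟨i, φ'⟩ ∧ Rep ψ ⟨i, ψ'⟩ := by
        rcases htot' (rep φ).1 (rep ψ).1 with h | h
        · exact ⟨_, _, _, hmove _ _ _ _ h (hrp φ), hrp ψ⟩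
        · exact ⟨_, _, _, hrp φ, hmove _ _ _ _ h (hrp ψ)⟩
      obtain ⟨i, φ', ψ', h1, h2⟩ := this
      rw [hvr φ i φ' h1, hvr ψ i ψ' h2, hvr (φ ⊓ ψ) i (φ' ⊓ ψ'), (hv i).2.2]
      intro N _ _ w
      rw [Formula.realize_inf, Formula.realize_inf, h1 N w, h2 N w]
  have helem : ∀ i, ElemMap (vs i) v (inc i) := by
    intro i φ
    symm
    apply hvr
    intro N _ _ w
    rw [Formula.realize_relabel]
  have hfull : IsFull v := by
    refine full_of_unit hvv fun ψ => ?_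
    obtain ⟨i, hi⟩ := hfin {x | Sum.inl x ∈ ψ.freeVarFinset} (by
      refine Set.Finite.preimage (f := (Sum.inl : S → S ⊕ Unit)) Sum.inl_injective.injOn
        ψ.freeVarFinset.finite_toSet)
    obtain ⟨ψ1, hψ1⟩ := exists_restrict (Sum.map (inc i) (id : Unit → Unit))
      ((hinc i).sumMap Function.injective_id) ψ (by
        rintro (d | d) hd
        · exact ⟨Sum.inl ⟨d, hi d hd⟩, rfl⟩
        · exact ⟨Sum.inr d, rfl⟩)
    obtain ⟨a, ha⟩ := full_unit (hv i) (hm i).2.1 ψ1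
    refine ⟨inc i a, ?_⟩
    have h1 : v (ψ.iExs Unit) = vs i (ψ1.iExs Unit) := by
      apply hvr
      intro N _ _ w
      rw [realize_exU, realize_exU]
      refine exists_congr fun x => ?_
      rw [hψ1]
      refine iff_of_eq ?_
      congr 1
      funext c; rcases c with c | c <;> rfl
    rw [h1, ha]
    symm
    apply hvr
    intro N _ _ w
    rw [realize_sub, realize_sub, hψ1]
    refine iff_of_eq ?_
    congr 1
    funext c; rcases c with c | c <;> rfl
  refine ⟨v, ⟨hvv.isBVal hfull ?_, hfull, ?_⟩, helem⟩
  · intro a b hab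
    obtain ⟨i, hi⟩ := hfin {a, b} (by simp)
    have h1 := hi a (by simp)
    have h2 := hi b (by simp)
    have h3 : (⟨a, h1⟩ : Ys i) = ⟨b, h2⟩ := by
      apply IsBVal.distinct (hm i).1
      rw [← hab]
      symm
      apply hvr
      intro N _ _ w
      simp only [Formula.realize_equal, Term.realize_var]
      rfl
    apply Subtype.ext
    exact congrArg (fun x : Ys i => (x : Z)) h3
  · let i := Classical.arbitrary I
    rw [← bmodels_relabel hvv (inc i)]
    intro φ hφ
    change v _ = ⊤
    rw [← helem i]
    exact (hm i).2.2 φ hφ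

/-- A model on a subset of `Z`. -/
structure Mod (B : Type) [CompleteBooleanAlgebra B] {L : FirstOrder.Language.{0, 0}}
    (T : L.Theory) (Z : Type) (κ : Cardinal.{0}) : Type where
  Y : Set Z
  v : L.Formula Y → B
  full : IsFullBModel T v
  card : #Y ≤ κ

theorem sat_ext {B : Type} [CompleteBooleanAlgebra B] {L : FirstOrder.Language.{0, 0}}
    (hL : L.card ≤ ℵ₀) {T : L.Theory} (hT : T.IsComplete) {C0 : Type} {v0 : L.Formula C0 → B}
    (h0 : IsFullBModel T v0) {lam : Cardinal.{0}} (hlam : ℵ₀ ≤ lam) :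
    ∃ (C : Type) (v : L.Formula C → B) (ι : C0 → C), IsFullBModel T v ∧ BSaturated T lam v ∧
      ElemMap v0 v ι := by
  classical
  let κ : Cardinal.{0} := 2 ^ (max lam (max #B #C0))
  have hκ1 : max lam (max #B #C0) ≤ κ := (cantor _).le
  have hlk : lam ≤ κ := (le_max_left _ _).trans hκ1
  have hBk : #B ≤ κ := ((le_max_left _ _).trans (le_max_right _ _)).trans hκ1
  have hCk : #C0 ≤ κ := ((le_max_right _ _).trans (le_max_right _ _)).trans hκ1
  have hκ : ℵ₀ ≤ κ := hlam.trans hlk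
  have hpow : κ ^ lam ≤ κ := by
    change (2 ^ (max lam (max #B #C0))) ^ lam ≤ 2 ^ (max lam (max #B #C0))
    rw [← power_mul, mul_eq_left (hlam.trans (le_max_left _ _)) (le_max_left _ _)
      (aleph0_pos.trans_le hlam).ne']
  let Z : Type := Set (Quotient.out κ)
  have hZ : κ < #Z := by
    rw [mk_set, mk_out]
    exact cantor κ
  let P := Mod B T Z κ
  let le : P → P → Prop := fun p q => ∃ h : p.Y ⊆ q.Y, ElemMap p.v q.v (Set.inclusion h)
  let sol : P → P → Prop := fun p q =>
    ∃ h : p.Y ⊆ q.Y, ElemMap p.v q.v (Set.inclusion h) ∧ Solves T lam p.v q.v (Set.inclusion h)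
  have hle : ∀ p q, sol p q → le p q := fun p q h => ⟨h.1, h.2.1⟩
  have hlesol : ∀ p q r, le p q → sol q r → sol p r := by
    rintro p q r ⟨h1, h2⟩ ⟨h3, h4, h5⟩
    refine ⟨h1.trans h3, ElemMap.comp (IsBVal.hv r.full.1) h2 h4, ?_⟩
    intro C0 C1 v0 v1 hm0 hm1 hC1 ι hι f hf
    obtain ⟨g, hg, hgι⟩ := h5 C0 C1 v0 v1 hm0 hm1 hC1 ι hι (Set.inclusion h1 ∘ f)
      (ElemMap.comp (IsBVal.hv q.full.1) hf h2)
    exact ⟨g, hg, hgι⟩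
  have hstep : ∀ p : P, ∃ q : P, sol p q := by
    intro p
    obtain ⟨Y', v', k, hY', hm', hk, hs⟩ := solve_step hL hT p.full hlam hκ p.card hBk hlk hpow
    obtain ⟨Y'', hYY, v'', k', hY'', hm'', hk', hkι⟩ := embed_model hκ hZ p.Y p.card hY' k
      (elem_injective p.full.1 (IsBVal.hv hm'.1) hk) hm'
    refine ⟨⟨Y'', v'', hm'', hY''⟩, hYY, ?_, ?_⟩
    · rw [← hkι]
      exact ElemMap.comp (IsBVal.hv hm''.1) hk hk'
    · intro C0 C1 v0 v1 hm0 hm1 hC1 ι hι f hf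
      obtain ⟨g, hg, hgι⟩ := hs C0 C1 v0 v1 hm0 hm1 hC1 ι hι f hf
      refine ⟨k' ∘ g, ElemMap.comp (IsBVal.hv hm''.1) hg hk', ?_⟩
      rw [← hkι, Function.comp_assoc, hgι]
      rfl
  -- the starting point
  obtain ⟨Y0, -, w0, k0, hY0, hmw0, hk0, -⟩ := embed_model hκ hZ (∅ : Set Z) (by simp) hCk
    (fun x => absurd x.2 (Set.notMem_empty _)) (fun x => absurd x.2 (Set.notMem_empty _)) h0
  let p0 : P := ⟨Y0, w0, hmw0, hY0⟩
  obtain ⟨M, hM, hpM⟩ := IsChain.exists_maxChain (IsChain.singleton (r := sol) (a := p0))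
  have hp0 : p0 ∈ M := hpM rfl
  have hrefl : ∀ p, le p p := by
    intro p
    refine ⟨subset_rfl, fun φ => ?_⟩
    have : Set.inclusion (subset_rfl : p.Y ⊆ p.Y) = id := by
      funext x
      rfl
    rw [this, (IsBVal.hv p.full.1).relabel_id]
  have htot : ∀ p ∈ M, ∀ q ∈ M, q = p ∨ sol p q ∨ sol q p := by
    intro p hp q hq
    by_cases h : q = p
    · exact Or.inl h
    · exact Or.inr (hM.1 hp hq (Ne.symm h))
  have htotle : ∀ p ∈ M, ∀ q ∈ M, le p q ∨ le q p := by
    intro p hp q hq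
    rcases htot p hp q hq with rfl | h | h
    · exact Or.inl (hrefl q)
    · exact Or.inl (hle _ _ h)
    · exact Or.inr (hle _ _ h)
  have hK : ∀ x : P, (∀ y ∈ M, le y x) → ∃ q ∈ M, sol x q := by
    intro x hx
    obtain ⟨q, hq⟩ := hstep x
    refine ⟨q, ?_, hq⟩
    have hc : IsChain sol (insert q M) := by
      refine hM.1.insert ?_
      intro y hy _
      exact Or.inr (hlesol y x q (hx y hy) hq)
    have := hM.2 hc (Set.subset_insert q M)
    rw [this]
    exact Set.mem_insert q M
  haveI : Nonempty M := ⟨⟨p0, hp0⟩⟩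
  obtain ⟨v, hv, hve⟩ := union_model (T := T) (fun p : M => p.1.Y) (fun p => p.1.v)
    (fun p => p.1.full) (fun p q => htotle p p.2 q q.2)
  refine ⟨_, v, Set.inclusion (Set.subset_iUnion (fun p : M => p.1.Y) ⟨p0, hp0⟩) ∘ k0, hv, ?_,
    ElemMap.comp (IsBVal.hv hv.1) hk0 (hve ⟨p0, hp0⟩)⟩
  intro D0 D1 u0 u1 hm0 hm1 hD1 ι hι f hf
  have hD0 : #D0 ≤ lam :=
    (mk_le_of_injective (elem_injective hm0.1 (IsBVal.hv hm1.1) hι)).trans hD1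
  have hx : ∀ c : D0, ∃ p : M, (f c : Z) ∈ p.1.Y := fun c => Set.mem_iUnion.1 (f c).2
  choose x hx using hx
  have hA : ∃ p ∈ M, ∀ c, (f c : Z) ∈ p.Y := by
    by_contra hno
    push Not at hno
    have hsub : (⋃ p : M, p.1.Y) ⊆ ⋃ c : D0, (x c).1.Y := by
      intro z hz
      obtain ⟨p, hp⟩ := Set.mem_iUnion.1 hz
      obtain ⟨c, hc⟩ := hno p p.2
      rcases htotle p p.2 (x c) (x c).2 with h | h
      · exact Set.mem_iUnion.2 ⟨c, h.1 hp⟩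
      · exact absurd (h.1 (hx c)) hc
    have hcard : #(⋃ p : M, p.1.Y) ≤ κ := by
      refine (mk_le_mk_of_subset hsub).trans ((mk_iUnion_le _).trans ?_)
      exact mul_le_of_le hκ (hD0.trans hlk) (ciSup_le' fun c => (x c).1.card)
    obtain ⟨q, hq, hq'⟩ := hK ⟨_, v, hv, hcard⟩ (fun y hy => ⟨_, hve ⟨y, hy⟩⟩)
    obtain ⟨c, hc⟩ := hno q hq
    exact hc (hq'.1 (f c).2)
  obtain ⟨p, hp, hpf⟩ := hA
  have hq : ∃ q ∈ M, sol p q := by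
    by_cases h : ∃ q ∈ M, sol p q
    · exact h
    · refine hK p fun y hy => ?_
      rcases htot p hp y hy with rfl | h' | h'
      · exact hrefl _
      · exact absurd ⟨y, hy, h'⟩ h
      · exact hle _ _ h'
  obtain ⟨q, hqM, hpq, hel, hs⟩ := hq
  let f' : D0 → p.Y := fun c => ⟨f c, hpf c⟩
  have hf' : ElemMap u0 p.v f' := by
    intro φ
    rw [hf φ, hve ⟨p, hp⟩, (IsBVal.hv hv.1).relabel_relabel]
    rfl
  obtain ⟨g, hg, hgι⟩ := hs D0 D1 u0 u1 hm0 hm1 hD1 ι hι f' hf'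
  refine ⟨Set.inclusion (Set.subset_iUnion (fun p : M => p.1.Y) ⟨q, hqM⟩) ∘ g,
    ElemMap.comp (IsBVal.hv hv.1) hg (hve ⟨q, hqM⟩), ?_⟩
  rw [Function.comp_assoc, hgι]
  rfl

end DLS

open FirstOrder FirstOrder.Language Cardinal
open BVal
namespace DLS

/-! ### Existence of specializations -/

theorem exists_spec {B : Type} [CompleteBooleanAlgebra B] {L : FirstOrder.Language.{0, 0}}
    {T : L.Theory} (hT : T.IsComplete) {C : Type} {v : L.Formula C → B}
    (h : IsFullBModel T v) {U : Set B} (hU : IsBUltrafilter U) :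
    ∃ (N : OrdStructure L) (π : C → N.carrier), IsSpecialization v U N.carrier π := by
  classical
  obtain ⟨⟨N⟩, hN⟩ := exists_model hT
  have hv := IsBVal.hv h.1
  let Ω := C → N
  obtain ⟨F, hFR, hF⟩ := sikorski_family (fun φ : L.Formula C => {ω : Ω | φ.Realize ω}) v (by
    intro u hu s
    obtain ⟨w, -, hw⟩ := exists_real_u hT hN hv h.2.2 hu s (θ := ⊤) (by
      have : v ⊤ = ⊤ := hv.1 _ fun N _ _ w => Formula.realize_top.2 trivial
      rw [this]
      exact buf_top hu)
    exact ⟨w, hw⟩)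
  let 𝒻 : Filter Ω :=
    { sets := {A | F A ∈ U}
      univ_sets := by
        change F ⊤ ∈ U
        rw [hF.2.2.1]
        exact buf_top hU
      sets_of_superset := fun {a b} ha hab => buf_mono hU ha (hF.2.2.2 hab)
      inter_sets := fun {a b} ha hb => by
        change F (a ⊓ b) ∈ U
        rw [hF.1]
        exact (buf_inf hU).2 ⟨ha, hb⟩ }
  have hmem : ∀ A : Set Ω, A ∈ 𝒻 ↔ F A ∈ U := fun A => Iff.rfl
  let 𝓊 : Ultrafilter Ω := Ultrafilter.ofComplNotMemIff 𝒻 (by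
    intro s
    rw [hmem, hmem, hF.2.1, buf_compl hU, not_not])
  let Q := (𝓊 : Filter Ω).Product fun _ => N
  let ev : C → Q := fun c => ((fun ω : Ω => ω c : Ω → N) : (𝓊 : Filter Ω).Product fun _ => N)
  have hlos : ∀ φ : L.Formula C, φ.Realize ev ↔ v φ ∈ U := by
    intro φ
    have := Ultraproduct.realize_formula_cast (M := fun _ : Ω => N) (u := 𝓊) φ
      (fun c (ω : Ω) => ω c)
    refine this.trans ?_
    rw [← hFR φ]
    exact hmem _
  have hwit : ∀ ψ : L.Formula (C ⊕ Unit), (∃ y : Q, ψ.Realize (Sum.elim ev fun _ => y)) →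
      ∃ c, ψ.Realize (Sum.elim ev fun _ => ev c) := by
    intro ψ hψ
    rw [← realize_exU, hlos] at hψ
    obtain ⟨a, ha⟩ := full_unit hv h.2.1 ψ
    rw [ha, ← hlos, realize_sub] at hψ
    exact ⟨a, hψ⟩
  let S : L.Substructure Q :=
    { carrier := Set.range ev
      fun_mem := by
        intro n f x hx
        choose c hc using hx
        obtain ⟨a, ha⟩ := hwit (Term.equal (Term.func f fun i => Term.var (Sum.inl (c i)))
          (Term.var (Sum.inr ()))) ⟨Structure.funMap f x, by
            rw [Formula.realize_equal]
            simp only [Term.realize_func, Term.realize_var, Sum.elim_inl, Sum.elim_inr]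
            congr 1
            funext i
            exact hc i⟩
        refine ⟨a, ?_⟩
        rw [Formula.realize_equal] at ha
        simp only [Term.realize_func, Term.realize_var, Sum.elim_inl, Sum.elim_inr] at ha
        rw [← ha]
        congr 1
        funext i
        exact hc i }
  let S' : L.ElementarySubstructure Q := S.toElementarySubstructure (by
    intro n φ x a hφ
    have hx : ∀ i, ∃ c, ev c = x i := fun i => (x i).2
    choose c hc using hx
    let ψ : L.Formula (C ⊕ Unit) := φ.toFormula.relabel
      (Sum.elim (fun e : Empty => e.elim)
        (Fin.snoc (α := fun _ => C ⊕ Unit) (fun i => Sum.inl (c i)) (Sum.inr ())))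
    have hψ : ∀ y : Q, ψ.Realize (Sum.elim ev fun _ => y) ↔
        φ.Realize default (Fin.snoc (Subtype.val ∘ x) y : _ → Q) := by
      intro y
      rw [Formula.realize_relabel, BoundedFormula.realize_toFormula]
      refine iff_of_eq ?_
      congr 1
      · exact Subsingleton.elim _ _
      · funext i
        refine Fin.lastCases ?_ (fun i => ?_) i
        · simp
        · simp [hc]
    obtain ⟨b, hb⟩ := hwit ψ ⟨a, (hψ a).2 hφ⟩
    exact ⟨⟨ev b, ⟨b, rfl⟩⟩, (hψ _).1 hb⟩)
  have : Nonempty C := full_nonempty h.2.1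
  let π : C → S' := fun c => ⟨ev c, ⟨c, rfl⟩⟩
  haveI : Nonempty S' := ⟨π (Classical.arbitrary C)⟩
  refine ⟨⟨S'⟩, π, ?_, ?_⟩
  · rintro ⟨x, c, rfl⟩
    exact ⟨c, rfl⟩
  · intro φ
    rw [← hlos]
    exact S'.subtype.map_formula φ π

end DLS

open FirstOrder FirstOrder.Language Cardinal
open BVal
namespace DLS

/-! ### The characterization of saturation by Łoś maps -/

/-- Every Łoś map of a type in `U` has a multiplicative refinement in `U`. -/
def LosProp {B : Type} [CompleteBooleanAlgebra B] {L : FirstOrder.Language.{0, 0}} (U : Set B)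
    (T : L.Theory) (lam : Cardinal.{0}) : Prop :=
  ∀ (C : Type) (v : L.Formula C → B), IsFullBModel T v → #C ≤ lam →
    ∀ χ : Quotient.out lam → L.Formula (C ⊕ Unit),
      (∀ s : Finset (Quotient.out lam), v ((fconj s χ).iExs Unit) ∈ U) →
      ∃ g : Quotient.out lam → B, (∀ i, g i ∈ U) ∧
        ∀ s : Finset (Quotient.out lam), s.inf g ≤ v ((fconj s χ).iExs Unit)

theorem exists_toB {L : FirstOrder.Language.{0, 0}} {C D : Type} (ψ : L.Formula (C ⊕ Unit))
    (f : C → D) : ∃ φ : L.BoundedFormula D 1, ∀ (N : Type) [L.Structure N] (w : D → N) (x : N),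
      φ.Realize w (fun _ => x) ↔ ψ.Realize (Sum.elim (w ∘ f) fun _ => x) := by
  refine ⟨BoundedFormula.relabel (n := 1) (k := 0) (Sum.map f fun _ => (0 : Fin 1)) ψ, ?_⟩
  intro N _ w x
  have := BoundedFormula.realize_relabel (m := 1) (n := 0) (φ := ψ)
    (g := (Sum.map f fun _ => (0 : Fin 1))) (v := w) (xs := fun _ : Fin 1 => x)
  refine this.trans ?_
  rw [Formula.Realize]
  have e : (Sum.elim w ((fun _ : Fin 1 => x) ∘ Fin.castAdd 0) ∘ Sum.map f fun _ : Unit => (0 : Fin 1))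
      = Sum.elim (w ∘ f) fun _ => x := by
    funext c; rcases c with c | c <;> rfl
  rw [e]
  have e2 : ((fun _ : Fin 1 => x) ∘ Fin.natAdd 1 : Fin 0 → N) = default := Subsingleton.elim _ _
  rw [e2]

theorem card_bf_le {L : FirstOrder.Language.{0, 0}} (hL : L.card ≤ ℵ₀) {C : Type}
    {κ : Cardinal.{0}} (hκ : ℵ₀ ≤ κ) (hC : #C ≤ κ) : #(L.BoundedFormula C 1) ≤ κ := by
  have h1 : #(L.BoundedFormula C 1) ≤ #(Σ n, L.BoundedFormula C n) :=
    mk_le_of_injective (f := fun φ : L.BoundedFormula C 1 => (⟨1, φ⟩ : Σ n, L.BoundedFormula C n)) (by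
      intro a b hab
      simpa using hab)
  refine h1.trans (BoundedFormula.card_le.trans ?_)
  simp only [lift_id]
  exact max_le hκ (add_le_of_le hκ hC (hL.trans hκ))

theorem saturates_imp {B : Type} [CompleteBooleanAlgebra B] {L : FirstOrder.Language.{0, 0}}
    (hL : L.card ≤ ℵ₀) {T : L.Theory} (hT : T.IsComplete) {U : Set B} (hU : IsBUltrafilter U)
    {lam : Cardinal.{0}} (hlam : ℵ₀ ≤ lam) (hsat : Saturates U T lam) : LosProp U T lam := by
  classical
  intro C v h hC χ hχ
  have hv := IsBVal.hv h.1
  obtain ⟨M, vM, j, hM, hMs, hj⟩ := sat_ext hL hT h hlam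
  have hvM := IsBVal.hv hM.1
  obtain ⟨⟨N⟩, π, hπ⟩ := exists_spec hT hM hU
  have hN : OrdSaturated L lam N := hsat M vM hM hMs N π hπ
  let rf : C → Set.range (π ∘ j) := fun c => ⟨π (j c), ⟨c, rfl⟩⟩
  choose φ hφ using fun i => exists_toB (χ i) rf
  have hφ' : ∀ i (b : N), (φ i).Realize Subtype.val (fun _ => b) ↔
      (χ i).Realize (Sum.elim (π ∘ j) fun _ => b) := fun i b => hφ i N _ b
  obtain ⟨b, hb⟩ := hN (Set.range (π ∘ j)) (mk_range_le.trans hC) (Set.range φ) (by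
    intro s hs
    obtain ⟨s', -, rfl⟩ := Finset.subset_set_image_iff.1 (hs.trans Set.image_univ.ge)
    have h1 := hχ s'
    rw [hj, hπ.2, Formula.realize_relabel, realize_exU] at h1
    obtain ⟨x, hx⟩ := h1
    rw [realize_fconj] at hx
    refine ⟨x, ?_⟩
    intro ψ hψ
    obtain ⟨i, hi, rfl⟩ := Finset.mem_image.1 hψ
    exact (hφ' i x).2 (hx i hi))
  obtain ⟨m, rfl⟩ := hπ.1 b
  refine ⟨fun i => vM ((χ i).relabel (Sum.elim j fun _ => m)), ?_, ?_⟩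
  · intro i
    rw [hπ.2, realize_sub]
    exact (hφ' i _).1 (hb _ ⟨i, rfl⟩)
  · intro s
    rw [hj, ← hvM.fconj]
    refine hvM.mono fun N _ _ w hw => ?_
    rw [realize_fconj] at hw
    rw [Formula.realize_relabel, realize_exU]
    refine ⟨w m, ?_⟩
    rw [realize_fconj]
    intro i hi
    exact (realize_sub _ _ _ _).1 (hw i hi)

theorem saturates_of {B : Type} [CompleteBooleanAlgebra B] {L : FirstOrder.Language.{0, 0}}
    (hL : L.card ≤ ℵ₀) {T : L.Theory} (hT : T.IsComplete) {U : Set B} (hU : IsBUltrafilter U)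
    {lam : Cardinal.{0}} (hlam : ℵ₀ ≤ lam) (hlos : LosProp U T lam) : Saturates U T lam := by
  classical
  intro M vM hM hMs N _ π hπ A hA p hp
  have hvM := IsBVal.hv hM.1
  have : Nonempty M := full_nonempty hM.2.1
  have : Nonempty N := ⟨π (Classical.arbitrary M)⟩
  rcases p.eq_empty_or_nonempty with rfl | hne
  · exact ⟨Classical.arbitrary N, by simp⟩
  choose a ha using fun x : A => hπ.1 x
  obtain ⟨Y, hAY, hYc, hYm⟩ := dls hL hM hlam (Set.range a) (mk_range_le.trans hA)
  let a' : A → Y := fun x => ⟨a x, hAY ⟨x, rfl⟩⟩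
  have hpc : #p ≤ #(Quotient.out lam) := by
    rw [mk_out]
    exact (mk_subtype_le _).trans (card_bf_le hL hlam hA)
  obtain ⟨e⟩ := (Cardinal.le_def _ _).1 hpc
  have : Nonempty p := hne.to_subtype
  let en : Quotient.out lam → p := Function.invFun e
  have hen : Function.Surjective en := Function.invFun_surjective e.injective
  let χ : Quotient.out lam → L.Formula (Y ⊕ Unit) := fun i =>
    (toU (en i).1).relabel (Sum.map a' id)
  have hχ : ∀ i (b : N), (χ i).Realize (Sum.elim (π ∘ Subtype.val) fun _ => b) ↔
      (en i).1.Realize Subtype.val (fun _ => b) := by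
    intro i b
    rw [Formula.realize_relabel, realize_toU]
    refine iff_of_eq ?_
    congr 1
    funext x
    exact ha x
  obtain ⟨g, hgU, hg⟩ := hlos Y _ hYm hYc χ (by
    intro s
    change vM _ ∈ U
    rw [hπ.2, Formula.realize_relabel, realize_exU]
    obtain ⟨b, hb⟩ := hp (s.image fun i => (en i).1) (by
      intro ψ hψ
      obtain ⟨i, -, rfl⟩ := Finset.mem_image.1 (Finset.mem_coe.1 hψ)
      exact (en i).2)
    refine ⟨b, ?_⟩
    rw [realize_fconj]
    intro i hi
    exact (hχ i b).2 (hb _ (Finset.mem_image_of_mem _ hi)))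
  obtain ⟨C1, v1, ι, c, hC1, hm1, hι, hc⟩ := one_ext hL hT hYm hlam hYc χ g hg
  obtain ⟨G, hG, hGι⟩ := hMs Y C1 _ v1 hYm hm1 hC1 ι hι Subtype.val (fun φ => rfl)
  refine ⟨π (G c), ?_⟩
  intro ψ hψ
  obtain ⟨i, hi⟩ := hen ⟨ψ, hψ⟩
  have h1 := buf_mono hU (hgU i) (hc i)
  rw [hG, hπ.2, Formula.realize_relabel, realize_sub, Function.comp_assoc, hGι, hχ, hi] at h1
  exact h1

end DLS

open FirstOrder FirstOrder.Language Cardinal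
open BVal
namespace DLS

/-! ### The small complete subalgebra -/

theorem card_lt_cc {B : Type} [CompleteBooleanAlgebra B] {S : Set B} (hS : IsBAntichain S) :
    #S < ccOf B := by
  have hne : {κ : Cardinal.{0} | ∀ S : Set B, IsBAntichain S → #S < κ}.Nonempty :=
    ⟨Order.succ #B, fun S _ => Order.lt_succ_of_le (mk_set_le S)⟩
  exact csInf_mem hne S hS

theorem lt_cof_of {lam κ : Cardinal.{0}} (hlam : ℵ₀ ≤ lam)
    (h : (2 : Cardinal.{0}) ^ κ ≤ (2 : Cardinal.{0}) ^ lam) :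
    κ < ((2 : Cardinal.{0}) ^ lam).ord.cof := by
  have h2 : (1 : Cardinal.{0}) < 2 := one_lt_two
  rcases le_total κ lam with h1 | h1
  · exact h1.trans_lt (lt_cof_ord_power hlam h2)
  · have : (2 : Cardinal.{0}) ^ lam = 2 ^ κ :=
      le_antisymm (power_le_power_left two_ne_zero h1) h
    rw [this]
    exact lt_cof_ord_power (hlam.trans h1) h2

theorem pow_le_of {lam κ : Cardinal.{0}} (hlam : ℵ₀ ≤ lam)
    (h : (2 : Cardinal.{0}) ^ κ ≤ (2 : Cardinal.{0}) ^ lam) :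
    ((2 : Cardinal.{0}) ^ lam) ^ κ ≤ 2 ^ lam := by
  rw [← power_mul]
  rcases le_total κ lam with h1 | h1
  · refine power_le_power_left two_ne_zero ?_
    exact (mul_le_mul_right h1 lam).trans (mul_eq_self hlam).le
  · refine le_trans (power_le_power_left two_ne_zero ?_) h
    exact (mul_le_mul_left h1 κ).trans (mul_eq_self (hlam.trans h1)).le

theorem iUnion_le_of {X ι : Type} {μ : Cardinal.{0}} (hμ : ℵ₀ ≤ μ) (f : ι → Set X) (hι : #ι ≤ μ)
    (hf : ∀ i, #(f i) ≤ μ) : #(⋃ i, f i) ≤ μ := by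
  refine (mk_iUnion_le f).trans ?_
  refine (mul_le_mul' hι (ciSup_le' hf)).trans (mul_eq_self hμ).le

theorem union_le_of {X : Type} {μ : Cardinal.{0}} (hμ : ℵ₀ ≤ μ) (s t : Set X) (hs : #s ≤ μ)
    (ht : #t ≤ μ) : #(s ∪ t : Set X) ≤ μ :=
  (mk_union_le s t).trans (add_le_of_le hμ hs ht)

theorem antichains_le {B : Type} [CompleteBooleanAlgebra B] {lam : Cardinal.{0}} (hlam : ℵ₀ ≤ lam)
    (hcc : ∀ κ : Cardinal.{0}, κ < ccOf B → (2 : Cardinal.{0}) ^ κ ≤ (2 : Cardinal.{0}) ^ lam)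
    (Y : Set B) (hY : #Y ≤ (2 : Cardinal.{0}) ^ lam) :
    #{S : Set B | S ⊆ Y ∧ IsBAntichain S} ≤ (2 : Cardinal.{0}) ^ lam := by
  set μ := (2 : Cardinal.{0}) ^ lam with hμdef
  have hμ : ℵ₀ ≤ μ := hlam.trans (cantor lam).le
  let I := {i : μ.ord.ToType // (2 : Cardinal.{0}) ^ #(Set.Iio i) ≤ μ}
  have hI : #I ≤ μ := (mk_subtype_le _).trans (by simp)
  have hsub : {S : Set B | S ⊆ Y ∧ IsBAntichain S} ⊆
      ⋃ i : I, {S : Set B | S ⊆ Y ∧ #S ≤ #(Set.Iio i.1)} := by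
    rintro S ⟨hSY, hS⟩
    have h1 := hcc _ (card_lt_cc hS)
    have h2 : #S < μ := (cantor _).trans_le h1
    have h3 : (#S).ord < Ordinal.type (α := μ.ord.ToType) (· < ·) := by
      rw [Ordinal.type_toType]
      exact ord_lt_ord.2 h2
    obtain ⟨i, hi⟩ := Ordinal.typein_surj (α := μ.ord.ToType) (· < ·) h3
    have h4 : #(Set.Iio i) = #S := by
      have := Ordinal.card_typein (r := ((· < ·) : μ.ord.ToType → μ.ord.ToType → Prop)) i
      rw [hi, card_ord] at this
      exact this.symm
    refine Set.mem_iUnion.2 ⟨⟨i, by rw [h4]; exact h1⟩, hSY, h4.ge⟩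
  refine (mk_le_mk_of_subset hsub).trans (iUnion_le_of hμ _ hI ?_)
  rintro ⟨i, hi⟩
  refine (mk_bounded_subset_le Y _).trans ?_
  refine (power_le_power_right (max_le hY hμ)).trans ?_
  exact pow_le_of hlam hi

/-- `A` has values in `U` but no multiplicative refinement in `U`. -/
def Bad {B : Type} [CompleteBooleanAlgebra B] {I : Type} (U : Set B) (A : Finset I → B) : Prop :=
  (∀ s, A s ∈ U) ∧ ¬ ∃ g : I → B, (∀ i, g i ∈ U) ∧ ∀ s : Finset I, s.inf g ≤ A s

theorem exists_sub {lam : Cardinal.{0}} (hlam : ℵ₀ ≤ lam)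
    {B : Type} [CompleteBooleanAlgebra B]
    (hcc : ∀ κ : Cardinal.{0}, κ < ccOf B → (2 : Cardinal.{0}) ^ κ ≤ (2 : Cardinal.{0}) ^ lam)
    (U : Set B) :
    ∃ Y : Set B, #Y ≤ (2 : Cardinal.{0}) ^ lam ∧ (∀ a ∈ Y, aᶜ ∈ Y) ∧ (∀ X ⊆ Y, sSup X ∈ Y) ∧
      (∀ A : Finset (Quotient.out lam) → B, (∀ s, A s ∈ Y) →
        (∃ g : Quotient.out lam → B, (∀ i, g i ∈ U) ∧ ∀ s : Finset (Quotient.out lam), s.inf g ≤ A s) →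
        ∃ g : Quotient.out lam → B, (∀ i, g i ∈ Y) ∧ (∀ i, g i ∈ U) ∧
          ∀ s : Finset (Quotient.out lam), s.inf g ≤ A s) ∧
      (∀ (v : Quotient.out lam → B) (a : Finset (Quotient.out lam) → Quotient.out lam),
        Bad U (v ∘ a) → ∃ v' : Quotient.out lam → B, (∀ i, v' i ∈ Y) ∧ Bad U (v' ∘ a) ∧
          ∀ s t : Finset (Quotient.out lam), s.inf v ≤ t.sup v ↔ s.inf v' ≤ t.sup v') := by
  classical
  set μ := (2 : Cardinal.{0}) ^ lam with hμdef
  have hμ : ℵ₀ ≤ μ := hlam.trans (cantor lam).le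
  have hlμ : lam ≤ μ := (cantor lam).le
  have hΛ : #(Quotient.out lam) = lam := mk_out lam
  have : Infinite (Quotient.out lam) := infinite_iff.2 (by rw [hΛ]; exact hlam)
  have hFΛ : #(Finset (Quotient.out lam)) = lam := by rw [mk_finset_of_infinite, hΛ]
  have hpow : μ ^ lam = μ := by rw [hμdef, ← power_mul, mul_eq_self hlam]
  -- witnesses
  have hd : ∀ A : Finset (Quotient.out lam) → B, ∃ g : Quotient.out lam → B,
      (∃ g : Quotient.out lam → B, (∀ i, g i ∈ U) ∧ ∀ s : Finset (Quotient.out lam), s.inf g ≤ A s) →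
      (∀ i, g i ∈ U) ∧ ∀ s : Finset (Quotient.out lam), s.inf g ≤ A s := by
    intro A
    by_cases h : (∃ g : Quotient.out lam → B,
      (∀ i, g i ∈ U) ∧ ∀ s : Finset (Quotient.out lam), s.inf g ≤ A s)
    · exact ⟨h.choose, fun _ => h.choose_spec⟩
    · exact ⟨fun _ => ⊥, fun h' => absurd h' h⟩
  choose G hG using hd
  have hc : ∀ p : Set (Finset (Quotient.out lam) × Finset (Quotient.out lam)) ×
      (Finset (Quotient.out lam) → Quotient.out lam), ∃ v : Quotient.out lam → B,
      (∃ v : Quotient.out lam → B, Bad U (v ∘ p.2) ∧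
        ∀ s t : Finset (Quotient.out lam), (s, t) ∈ p.1 ↔ s.inf v ≤ t.sup v) →
      Bad U (v ∘ p.2) ∧
        ∀ s t : Finset (Quotient.out lam), (s, t) ∈ p.1 ↔ s.inf v ≤ t.sup v := by
    intro p
    by_cases h : (∃ v : Quotient.out lam → B, Bad U (v ∘ p.2) ∧
        ∀ s t : Finset (Quotient.out lam), (s, t) ∈ p.1 ↔ s.inf v ≤ t.sup v)
    · exact ⟨h.choose, fun _ => h.choose_spec⟩
    · exact ⟨fun _ => ⊥, fun h' => absurd h' h⟩
  choose V hV using hc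
  let Y0 : Set B := ⋃ p, Set.range (V p)
  have hY0 : #Y0 ≤ μ := by
    refine iUnion_le_of hμ _ ?_ fun p => mk_range_le.trans (by rw [hΛ]; exact hlμ)
    rw [mk_prod, lift_id, lift_id, mk_set, mk_prod, lift_id, hFΛ, mul_eq_self hlam]
    have : #(Finset (Quotient.out lam) → Quotient.out lam) ≤ μ := by
      rw [← power_def, hΛ, hFΛ, power_self_eq hlam]
    exact (mul_le_mul' le_rfl this).trans (mul_eq_self hμ).le
  let Step : Set B → Set B := fun Y =>
    ((compl '' Y ∪ (fun p : B × B => p.1 ⊓ p.2) '' (Y ×ˢ Y)) ∪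
      sSup '' {S : Set B | S ⊆ Y ∧ IsBAntichain S}) ∪
      ⋃ A : Finset (Quotient.out lam) → Y, Set.range (G fun s => (A s).1)
  have hStep : ∀ Y : Set B, #Y ≤ μ → #(Step Y) ≤ μ := by
    intro Y hY
    refine union_le_of hμ _ _ (union_le_of hμ _ _ (union_le_of hμ _ _ ?_ ?_) ?_) ?_
    · exact mk_image_le.trans hY
    · refine mk_image_le.trans ?_
      rw [mk_setProd]
      exact (mul_le_mul' hY hY).trans (mul_eq_self hμ).le
    · exact mk_image_le.trans (antichains_le hlam hcc Y hY)
    · refine iUnion_le_of hμ _ ?_ fun p => mk_range_le.trans (by rw [hΛ]; exact hlμ)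
      rw [← power_def, hFΛ]
      exact (power_le_power_right hY).trans hpow.le
  obtain ⟨Y, hY0Y, hY, hcl⟩ := closure_lemma hμ Step hStep Y0 hY0
  have hlc : lam < μ.ord.cof := lt_cof_of hlam le_rfl
  have hcompl : ∀ a ∈ Y, aᶜ ∈ Y := by
    intro a ha
    obtain ⟨Y1, -, h1, h2⟩ := hcl {a} (by simpa using ha) (by
      rw [mk_singleton]; exact (one_lt_aleph0.trans_le hlam).trans hlc)
    exact h2 (Or.inl (Or.inl (Or.inl ⟨a, h1 rfl, rfl⟩)))
  have hinf : ∀ a ∈ Y, ∀ b ∈ Y, a ⊓ b ∈ Y := by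
    intro a ha b hb
    obtain ⟨Y1, -, h1, h2⟩ := hcl {a, b} (by
      rintro x (rfl | rfl)
      · exact ha
      · exact hb) (by
      refine (lt_of_lt_of_le ?_ hlam).trans hlc
      exact (Set.toFinite ({a, b} : Set B)).lt_aleph0)
    exact h2 (Or.inl (Or.inl (Or.inr ⟨(a, b), ⟨h1 (by simp), h1 (by simp)⟩, rfl⟩)))
  have hanti : ∀ S ⊆ Y, IsBAntichain S → sSup S ∈ Y := by
    intro S hSY hS
    obtain ⟨Y1, -, h1, h2⟩ := hcl S hSY (lt_cof_of hlam (hcc _ (card_lt_cc hS)))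
    exact h2 (Or.inl (Or.inr ⟨S, ⟨h1, hS⟩, rfl⟩))
  refine ⟨Y, hY, hcompl, ?_, ?_, ?_⟩
  · intro X hX
    obtain ⟨S, hS⟩ := zorn_subset {S : Set B | (S ⊆ Y ∧ IsBAntichain S) ∧ ∀ a ∈ S, ∃ x ∈ X, a ≤ x} (by
      intro c hc hch
      refine ⟨⋃₀ c, ⟨⟨Set.sUnion_subset fun s hs => (hc hs).1.1, ?_, ?_⟩, ?_⟩,
        fun s hs => Set.subset_sUnion_of_mem hs⟩
      · rintro a ⟨s, hs, ha⟩
        exact (hc hs).1.2.1 a ha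
      · exact (Set.pairwise_sUnion hch.directedOn).2 fun s hs => (hc hs).1.2.2
      · rintro a ⟨s, hs, ha⟩
        exact (hc hs).2 a ha)
    obtain ⟨⟨hSY, hSa⟩, hSX⟩ := hS.prop
    have hSs := hanti S hSY hSa
    have : sSup X = sSup S := by
      apply le_antisymm
      · refine sSup_le fun x hx => ?_
        by_contra hcon
        set d := x ⊓ (sSup S)ᶜ with hdd
        have hd0 : d ≠ ⊥ := by
          intro h0
          apply hcon
          rw [← sdiff_eq_bot_iff, sdiff_eq]
          exact h0
        have hdS : ∀ b ∈ S, d ⊓ b = ⊥ := by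
          intro b hb
          rw [← le_bot_iff]
          calc d ⊓ b ≤ (sSup S)ᶜ ⊓ sSup S := inf_le_inf inf_le_right (le_sSup hb)
            _ = ⊥ := compl_inf_eq_bot
        have hmem : insert d S ∈ {S : Set B | (S ⊆ Y ∧ IsBAntichain S) ∧ ∀ a ∈ S, ∃ x ∈ X, a ≤ x} := by
          refine ⟨⟨Set.insert_subset (hinf x (hX hx) _ (hcompl _ hSs)) hSY, ?_, ?_⟩, ?_⟩
          · rintro a (rfl | ha)
            · exact hd0
            · exact hSa.1 a ha
          · refine hSa.2.insert fun b hb _ => ⟨hdS b hb, ?_⟩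
            rw [inf_comm]; exact hdS b hb
          · rintro a (rfl | ha)
            · exact ⟨x, hx, inf_le_left⟩
            · exact hSX a ha
        have h3 := hS.le_of_ge hmem (Set.subset_insert d S) (Set.mem_insert d S)
        have h4 := hdS d h3
        rw [inf_idem] at h4
        exact hd0 h4
      · refine sSup_le fun a ha => ?_
        obtain ⟨x, hx, hax⟩ := hSX a ha
        exact hax.trans (le_sSup hx)
    rw [this]
    exact hSs
  · intro A hA hg
    obtain ⟨Y1, -, h1, h2⟩ := hcl (Set.range A) (by rintro _ ⟨s, rfl⟩; exact hA s) (by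
      refine lt_of_le_of_lt mk_range_le ?_
      rw [hFΛ]; exact hlc)
    refine ⟨G A, ?_, hG A hg⟩
    intro i
    exact h2 (Or.inr (Set.mem_iUnion.2 ⟨fun s => ⟨A s, h1 ⟨s, rfl⟩⟩, i, rfl⟩))
  · intro v a hbad
    let p : Set (Finset (Quotient.out lam) × Finset (Quotient.out lam)) ×
      (Finset (Quotient.out lam) → Quotient.out lam) := ({q | q.1.inf v ≤ q.2.sup v}, a)
    have h1 := hV p ⟨v, hbad, fun s t => Iff.rfl⟩
    exact ⟨V p, fun i => hY0Y (Set.mem_iUnion.2 ⟨p, i, rfl⟩), h1.1, h1.2⟩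

end DLS

open FirstOrder FirstOrder.Language Cardinal
open BVal
namespace DLS

/-! ### Transfer between the two algebras -/

theorem pattern_model {B B' : Type} [CompleteBooleanAlgebra B] [CompleteBooleanAlgebra B']
    {L : FirstOrder.Language.{0, 0}} {T : L.Theory} {C : Type} {v : L.Formula C → B}
    {v' : L.Formula C → B'}
    (hp : ∀ s t : Finset (L.Formula C), s.inf v ≤ t.sup v ↔ s.inf v' ≤ t.sup v')
    (h : IsFullBModel T v) : IsFullBModel T v' := by
  classical
  have hle : ∀ φ ψ, v φ ≤ v ψ → v' φ ≤ v' ψ := fun φ ψ => by simpa using (hp {φ} {ψ}).1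
  have heq : ∀ φ ψ, v φ = v ψ → v' φ = v' ψ := fun φ ψ h =>
    le_antisymm (hle _ _ h.le) (hle _ _ h.ge)
  have htop : ∀ φ, v φ = ⊤ ↔ v' φ = ⊤ := fun φ => by
    simpa using hp ∅ {φ}
  have hv := IsBVal.hv h.1
  have hv' : HV v' := by
    refine ⟨fun φ hφ => (htop φ).1 (hv.1 φ hφ), ?_, ?_⟩
    · intro φ
      have h1 := (hp {φ, φ.not} ∅).1 (by simp [hv.2.1])
      have h2 := (hp ∅ {φ, φ.not}).1 (by simp [hv.2.1])
      have h3 : IsCompl (v' φ) (v' φ.not) :=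
        IsCompl.of_le (by simpa using h1) (by simpa using h2)
      exact h3.compl_eq.symm
    · intro φ ψ
      apply le_antisymm
      · exact le_inf (hle _ _ (by rw [hv.2.2]; exact inf_le_left))
          (hle _ _ (by rw [hv.2.2]; exact inf_le_right))
      · have h1 := (hp {φ, ψ} {φ ⊓ ψ}).1 (by simp [hv.2.2])
        simpa using h1
  have hf : IsFull v' := by
    intro φ
    obtain ⟨a, ha⟩ := h.2.1 φ
    exact ⟨a, heq _ _ ha⟩
  exact ⟨hv'.isBVal hf fun a b hab => IsBVal.distinct h.1 a b ((htop _).2 hab), hf,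
    fun φ hφ => (htop _).1 (h.2.2 φ hφ)⟩

theorem exists_cba {B : Type} [CompleteBooleanAlgebra B] (Y : Set B) (hc : ∀ a ∈ Y, aᶜ ∈ Y)
    (hs : ∀ X ⊆ Y, sSup X ∈ Y) : ∃ _ : CompleteBooleanAlgebra Y,
      (∀ X : Set Y, (sSup X).1 = sSup (Subtype.val '' X)) ∧ (∀ a b : Y, (a ⊓ b).1 = a.1 ⊓ b.1) ∧
      (∀ a : Y, (aᶜ).1 = (a.1)ᶜ) ∧ (⊤ : Y).1 = ⊤ ∧ (⊥ : Y).1 = ⊥ := by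
  have hbot : ⊥ ∈ Y := by simpa using hs ∅ (by simp)
  have htop : ⊤ ∈ Y := by simpa using hc _ hbot
  have hsup : ∀ a ∈ Y, ∀ b ∈ Y, a ⊔ b ∈ Y := by
    intro a ha b hb
    have := hs {a, b} (by rintro x (rfl | rfl) <;> assumption)
    simpa [sSup_insert] using this
  have hinf : ∀ a ∈ Y, ∀ b ∈ Y, a ⊓ b ∈ Y := by
    intro a ha b hb
    have := hc _ (hsup _ (hc a ha) _ (hc b hb))
    simpa using this
  have hsI : ∀ X ⊆ Y, sInf X ∈ Y := by
    intro X hX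
    have h1 := hc _ (hs (compl '' X) (by rintro _ ⟨x, hx, rfl⟩; exact hc x (hX hx)))
    have h2 : (sSup (compl '' X))ᶜ = sInf X := by
      rw [sSup_image, compl_iSup, sInf_eq_iInf]
      simp [compl_iSup]
    rwa [h2] at h1
  let i1 : Max Y := ⟨fun a b => ⟨a.1 ⊔ b.1, hsup _ a.2 _ b.2⟩⟩
  let i2 : Min Y := ⟨fun a b => ⟨a.1 ⊓ b.1, hinf _ a.2 _ b.2⟩⟩
  let i3 : SupSet Y := ⟨fun X => ⟨sSup (Subtype.val '' X), hs _ (by rintro _ ⟨x, -, rfl⟩; exact x.2)⟩⟩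
  let i4 : InfSet Y := ⟨fun X => ⟨sInf (Subtype.val '' X), hsI _ (by rintro _ ⟨x, -, rfl⟩; exact x.2)⟩⟩
  let i5 : Top Y := ⟨⟨⊤, htop⟩⟩
  let i6 : Bot Y := ⟨⟨⊥, hbot⟩⟩
  let i7 : Compl Y := ⟨fun a => ⟨(a.1)ᶜ, hc _ a.2⟩⟩
  let i8 : HImp Y := ⟨fun a b => ⟨a.1 ⇨ b.1, by
    rw [himp_eq]; exact hsup _ b.2 _ (hc _ a.2)⟩⟩
  let i9 : SDiff Y := ⟨fun a b => ⟨a.1 \ b.1, by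
    rw [sdiff_eq]; exact hinf _ a.2 _ (hc _ b.2)⟩⟩
  refine ⟨Function.Injective.completeBooleanAlgebra (Subtype.val : Y → B) Subtype.val_injective
    Iff.rfl Iff.rfl (fun _ _ => rfl) (fun _ _ => rfl) (fun s => ?_) (fun s => ?_) rfl rfl
    (fun _ => rfl) (fun _ _ => rfl) (fun _ _ => rfl), fun _ => rfl, fun _ _ => rfl, fun _ => rfl,
    rfl, rfl⟩
  · exact sSup_image
  · exact sInf_image

theorem exists_cba' {B : Type} [CompleteBooleanAlgebra B] (Y : Set B) (hc : ∀ a ∈ Y, aᶜ ∈ Y)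
    (hs : ∀ X ⊆ Y, sSup X ∈ Y) : ∃ (Z : Type) (_ : CompleteBooleanAlgebra Z) (e : Z → B),
      Function.Injective e ∧ (∀ z, e z ∈ Y) ∧ (∀ y ∈ Y, ∃ z, e z = y) ∧ #Z = #Y ∧
      (∀ X : Set Z, e (sSup X) = sSup (e '' X)) ∧ (∀ a b : Z, e (a ⊓ b) = e a ⊓ e b) ∧
      (∀ a : Z, e aᶜ = (e a)ᶜ) ∧ e ⊤ = ⊤ ∧ e ⊥ = ⊥ := by
  obtain ⟨inst, h⟩ := exists_cba Y hc hs
  exact ⟨Y, inst, Subtype.val, Subtype.val_injective, fun z => z.2, fun y hy => ⟨⟨y, hy⟩, rfl⟩,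
    rfl, h⟩

theorem main (lam : Cardinal) (hlam : ℵ₀ ≤ lam)
    (B : Type) [CompleteBooleanAlgebra B]
    (hcc : ∀ κ : Cardinal, κ < ccOf B → (2 : Cardinal) ^ κ ≤ (2 : Cardinal) ^ lam)
    (U : Set B) (hU : IsBUltrafilter U) :
    ∃ (Bs : CBA) (e : Bs.carrier → B),
      Function.Injective e ∧
      (∀ X : Set Bs.carrier, e (sSup X) = sSup (e '' X)) ∧
      (∀ a b : Bs.carrier, e (a ⊓ b) = e a ⊓ e b) ∧
      (∀ a : Bs.carrier, e aᶜ = (e a)ᶜ) ∧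
      e ⊤ = ⊤ ∧ e ⊥ = ⊥ ∧
      Cardinal.mk Bs.carrier ≤ 2 ^ lam ∧
      IsBUltrafilter (e ⁻¹' U) ∧
      ∀ (L : FirstOrder.Language.{0, 0}), L.card ≤ ℵ₀ →
        ∀ T : L.Theory, T.IsComplete →
          (Saturates (e ⁻¹' U) T lam ↔ Saturates U T lam) := by
  classical
  obtain ⟨Y, hY, hYc, hYs, hYd, hYp⟩ := exists_sub hlam hcc U
  obtain ⟨Z, inst, e, eInj, eY, eY', eCard, eS, eI, eC, eT, eB⟩ := exists_cba' Y hYc hYs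
  rw [← eCard] at hY
  have eLe : ∀ a b : Z, a ≤ b ↔ e a ≤ e b := by
    intro a b
    rw [← inf_eq_left, ← inf_eq_left, ← eI]
    exact eInj.eq_iff.symm
  have eSup : ∀ a b : Z, e (a ⊔ b) = e a ⊔ e b := by
    intro a b
    have : a ⊔ b = (aᶜ ⊓ bᶜ)ᶜ := by simp
    rw [this]
    rw [eC, eI, eC, eC]
    simp
  have eFI : ∀ {I : Type} (s : Finset I) (f : I → Z), e (s.inf f) = s.inf (e ∘ f) := by
    intro I s f
    induction s using Finset.induction_on with
    | empty => exact eT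
    | insert a s ha ih =>
      rw [Finset.inf_insert, Finset.inf_insert, ← ih]
      exact eI _ _
  have eFS : ∀ {I : Type} (s : Finset I) (f : I → Z), e (s.sup f) = s.sup (e ∘ f) := by
    intro I s f
    induction s using Finset.induction_on with
    | empty => exact eB
    | insert a s ha ih =>
      rw [Finset.sup_insert, Finset.sup_insert, ← ih]
      exact eSup _ _
  have hUs : IsBUltrafilter (e ⁻¹' U) := by
    refine ⟨⟨?_, ?_, ?_, ?_⟩, ?_⟩
    · change e ⊤ ∈ U
      rw [show e ⊤ = ⊤ from eT]; exact hU.1.1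
    · change ¬ e ⊥ ∈ U
      rw [show e ⊥ = ⊥ from eB]; exact hU.1.2.1
    · intro a b ha hab
      exact hU.1.2.2.1 _ _ ha ((eLe a b).1 hab)
    · intro a b ha hb
      change e (a ⊓ b) ∈ U
      rw [show e (a ⊓ b) = e a ⊓ e b from eI a b]
      exact hU.1.2.2.2 _ _ ha hb
    · intro a
      rcases hU.2 (e a) with h | h
      · exact Or.inl h
      · right
        change e aᶜ ∈ U
        rw [show e aᶜ = (e a)ᶜ from eC a]
        exact h
  refine ⟨⟨Z⟩, e, eInj, eS, eI, eC, eT, eB, hY, hUs, ?_⟩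
  intro L hL T hT
  constructor
  · intro hsat
    have hlos := saturates_imp hL hT hUs hlam hsat
    refine saturates_of hL hT hU hlam ?_
    intro C v hv hC χ hχ
    by_contra hcon
    have hF : #(L.Formula C) ≤ #(Quotient.out lam) := by
      rw [mk_out]
      exact card_formula_le hL hlam hC
    obtain ⟨⟨k, hk⟩⟩ := hF
    let r : Quotient.out lam → L.Formula C := Function.invFun k
    have hrk : ∀ φ, r (k φ) = φ := Function.leftInverse_invFun hk
    let a : Finset (Quotient.out lam) → Quotient.out lam := fun s => k ((fconj s χ).iExs Unit)
    have ha : (v ∘ r) ∘ a = fun s => v ((fconj s χ).iExs Unit) := by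
      funext s
      simp only [Function.comp, a, hrk]
    obtain ⟨v1, h1Y, h1bad, h1p⟩ := hYp (v ∘ r) a (by rw [ha]; exact ⟨hχ, hcon⟩)
    choose v' hv' using fun φ => eY' (v1 (k φ)) (h1Y _)
    have hv'' : e ∘ v' = v1 ∘ k := funext hv'
    have hp : ∀ s t : Finset (L.Formula C), s.inf v ≤ t.sup v ↔ s.inf v' ≤ t.sup v' := by
      intro s t
      have h2 := h1p (s.image k) (t.image k)
      have e3 : (v ∘ r) ∘ k = v := by funext φ; simp [hrk]
      rw [Finset.inf_image, Finset.inf_image, Finset.sup_image, Finset.sup_image, e3] at h2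
      rw [h2, eLe, eFI, eFS, hv'']
    obtain ⟨g, hg1, hg2⟩ := hlos C v' (pattern_model hp hv) hC χ (fun s => by
      change e _ ∈ U
      rw [hv']
      exact h1bad.1 s)
    refine h1bad.2 ⟨e ∘ g, hg1, ?_⟩
    intro s
    have := (eLe _ _).1 (hg2 s)
    rw [eFI, hv'] at this
    exact this
  · intro hsat
    have hlos := saturates_imp hL hT hU hlam hsat
    refine saturates_of hL hT hUs hlam ?_
    intro C v hv hC χ hχ
    have hp : ∀ s t : Finset (L.Formula C), s.inf v ≤ t.sup v ↔ s.inf (e ∘ v) ≤ t.sup (e ∘ v) := by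
      intro s t
      rw [eLe, eFI, eFS]
    have h1 := hlos C (e ∘ v) (pattern_model hp hv) hC χ hχ
    obtain ⟨g, hgY, hgU, hg⟩ := hYd (fun s => e (v ((fconj s χ).iExs Unit)))
      (fun s => eY _) h1
    choose g' hg' using fun i => eY' (g i) (hgY i)
    have hg'' : e ∘ g' = g := funext hg'
    refine ⟨g', fun i => by change e _ ∈ U; rw [hg']; exact hgU i, ?_⟩
    intro s
    rw [eLe, eFI, hg'']
    exact hg s

end DLS

/-- **Downward Löwenheim–Skolem for saturation** (Theorem 9.1). -/
theorem stmt18_dls_for_saturation (lam : Cardinal) (hlam : ℵ₀ ≤ lam)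
    (B : Type) [CompleteBooleanAlgebra B]
    (hcc : ∀ κ : Cardinal, κ < ccOf B → (2 : Cardinal) ^ κ ≤ (2 : Cardinal) ^ lam)
    (U : Set B) (hU : IsBUltrafilter U) :
    ∃ (Bs : CBA) (e : Bs.carrier → B),
      Function.Injective e ∧
      (∀ X : Set Bs.carrier, e (sSup X) = sSup (e '' X)) ∧
      (∀ a b : Bs.carrier, e (a ⊓ b) = e a ⊓ e b) ∧
      (∀ a : Bs.carrier, e aᶜ = (e a)ᶜ) ∧
      e ⊤ = ⊤ ∧ e ⊥ = ⊥ ∧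
      Cardinal.mk Bs.carrier ≤ 2 ^ lam ∧
      IsBUltrafilter (e ⁻¹' U) ∧
      ∀ (L : FirstOrder.Language.{0, 0}), L.card ≤ ℵ₀ →
        ∀ T : L.Theory, T.IsComplete →
          (Saturates (e ⁻¹' U) T lam ↔ Saturates U T lam) := by
  exact DLS.main lam hlam B hcc U hU
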